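/- arXiv:2303.04728 — 2 statements merged into one kernel-verified Lean document; each statement's English description precedes it below -/
import Mathlib

section
/- Let 1 < q < ∞ and 1 < r < ∞, and for each n let X^{(n)} be uniformly distributed on D_{q,1}^n := vol_n(B_{q,1}^n)^{-1/n} B_{q,1}^n. Then n^{-1/r} ‖X^{(n)}‖_r converges in probability, as n → ∞, to m_{q,r} := (1/(2 e^{1/q})) · (q/(q-1)) · ( Γ(r+1) Γ(1 + q/(q-1)) / Γ(r+1 + q/(q-1)) )^{1/r}. -/
open MeasureTheory Finset Filter
open scoped ENNReal NNReal

noncomputable section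

/-- `sortedAbs x i` is the `i`-th largest value among `|x 0|, …, |x (n-1)|`
(`i = 0` gives the largest), i.e. the non-increasing rearrangement of `|x|`. -/
def sortedAbs {n : ℕ} (x : Fin n → ℝ) (i : Fin n) : ℝ :=
  |x (Tuple.sort (fun j => |x j|) i.rev)|

/-- The Lorentz norm `‖x‖_{q,1} = ∑_{i=1}^n i^{1/q-1} x_i^*` for `1 < q < ∞`. -/
def lorentzNorm (q : ℝ) {n : ℕ} (x : Fin n → ℝ) : ℝ :=
  ∑ i : Fin n, ((i : ℝ) + 1) ^ (1 / q - 1) * sortedAbs x i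

/-- The unit ball of the Lorentz space `ℓ_{q,1}^n`. -/
def lorentzBall (q : ℝ) (n : ℕ) : Set (Fin n → ℝ) :=
  {x | lorentzNorm q x ≤ 1}

/-- The volume-normalized Lorentz ball `D_{q,1}^n = vol_n(B_{q,1}^n)^{-1/n} B_{q,1}^n`. -/
def volNormLorentzBall (q : ℝ) (n : ℕ) : Set (Fin n → ℝ) :=
  (fun x => ((volume (lorentzBall q n)).toReal ^ (-(1 : ℝ) / n)) • x) '' lorentzBall q n

/-- The uniform probability measure on a set (normalized restricted Lebesgue measure). -/
def unifOn {n : ℕ} (s : Set (Fin n → ℝ)) : Measure (Fin n → ℝ) :=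
  (volume s)⁻¹ • volume.restrict s

/-- The constant `m_{q,r}` of Theorem D. -/
def mqr (q r : ℝ) : ℝ :=
  1 / (2 * Real.exp (1 / q)) * (q / (q - 1)) *
    (Real.Gamma (r + 1) * Real.Gamma (1 + q / (q - 1)) / Real.Gamma (r + 1 + q / (q - 1)))
      ^ (1 / r)

/-- Partial sums of `(i + 1) ^ (b - 1)` grow like `m ^ b / b`. -/
lemma sum_rpow_bounds {b : ℝ} (hb : 0 < b) (hb1 : b ≤ 1) (m : ℕ) :
    (((m : ℝ) + 1) ^ b - 1) / b ≤ ∑ i ∈ range m, ((i : ℝ) + 1) ^ (b - 1) ∧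
      ∑ i ∈ range m, ((i : ℝ) + 1) ^ (b - 1) ≤ (m : ℝ) ^ b / b := by
  have key1 : ∀ i : ℕ, ((i : ℝ) + 1 + 1) ^ b - ((i : ℝ) + 1) ^ b ≤ b * ((i : ℝ) + 1) ^ (b - 1) := by
    intro i
    have hi : (0 : ℝ) < (i : ℝ) + 1 := by positivity
    have h := rpow_one_add_le_one_add_mul_self (s := 1 / ((i : ℝ) + 1)) (p := b)
      (by have : 0 < 1 / ((i : ℝ) + 1) := by positivity
          linarith) hb.le hb1
    have h2 : ((i : ℝ) + 1 + 1) ^ b = ((i : ℝ) + 1) ^ b * (1 + 1 / ((i : ℝ) + 1)) ^ b := by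
      rw [← Real.mul_rpow hi.le (by positivity)]
      congr 1
      field_simp
    rw [h2, Real.rpow_sub_one hi.ne']
    have h3 := mul_le_mul_of_nonneg_left h (Real.rpow_nonneg hi.le b)
    calc _ ≤ ((i : ℝ) + 1) ^ b * (1 + b * (1 / ((i : ℝ) + 1))) - ((i : ℝ) + 1) ^ b := by linarith
      _ = _ := by ring
  have key2 : ∀ i : ℕ, b * ((i : ℝ) + 1) ^ (b - 1) ≤ ((i : ℝ) + 1) ^ b - (i : ℝ) ^ b := by
    intro i
    have hi : (0 : ℝ) < (i : ℝ) + 1 := by positivity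
    have hle : 1 / ((i : ℝ) + 1) ≤ 1 := by
      rw [div_le_one hi]; linarith [Nat.cast_nonneg (α := ℝ) i]
    have h := rpow_one_add_le_one_add_mul_self (s := -(1 / ((i : ℝ) + 1))) (p := b)
      (by linarith) hb.le hb1
    have h2 : (i : ℝ) ^ b = ((i : ℝ) + 1) ^ b * (1 + -(1 / ((i : ℝ) + 1))) ^ b := by
      rw [← Real.mul_rpow hi.le (by linarith)]
      congr 1
      field_simp
      ring
    rw [h2, Real.rpow_sub_one hi.ne']
    have h3 := mul_le_mul_of_nonneg_left h (Real.rpow_nonneg hi.le b)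
    calc _ = ((i : ℝ) + 1) ^ b - ((i : ℝ) + 1) ^ b * (1 + b * -(1 / ((i : ℝ) + 1))) := by ring
      _ ≤ _ := by linarith
  constructor
  · rw [div_le_iff₀' hb, mul_sum]
    calc ((m : ℝ) + 1) ^ b - 1
        = ∑ i ∈ range m, (((i : ℝ) + 1 + 1) ^ b - ((i : ℝ) + 1) ^ b) := by
          have := sum_range_sub (fun i : ℕ => ((i : ℝ) + 1) ^ b) m
          push_cast at this
          rw [this]; simp
      _ ≤ _ := sum_le_sum fun i _ => key1 i
  · rw [le_div_iff₀' hb, mul_sum]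
    calc _ ≤ ∑ i ∈ range m, (((i : ℝ) + 1) ^ b - (i : ℝ) ^ b) := sum_le_sum fun i _ => key2 i
      _ = (m : ℝ) ^ b := by
          have := sum_range_sub (fun i : ℕ => (i : ℝ) ^ b) m
          push_cast at this
          rw [this]; simp [Real.zero_rpow hb.ne']

lemma tendsto_sum_rpow_div {b : ℝ} (hb : 0 < b) (hb1 : b ≤ 1) :
    Tendsto (fun m : ℕ => (∑ i ∈ range m, ((i : ℝ) + 1) ^ (b - 1)) / (m : ℝ) ^ b) atTop
      (nhds (1 / b)) := by
  have hpow : Tendsto (fun m : ℕ => (m : ℝ) ^ b) atTop atTop :=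
    (tendsto_rpow_atTop hb).comp tendsto_natCast_atTop_atTop
  have hlow : Tendsto (fun m : ℕ => 1 / b - 1 / b * ((m : ℝ) ^ b)⁻¹) atTop (nhds (1 / b)) := by
    simpa using (tendsto_const_nhds (x := 1 / b)).sub
      ((tendsto_inv_atTop_zero.comp hpow).const_mul (1 / b))
  refine tendsto_of_tendsto_of_tendsto_of_le_of_le' hlow tendsto_const_nhds ?_ ?_
  · filter_upwards [eventually_gt_atTop 0] with m hm
    have hm' : (0 : ℝ) < m := by exact_mod_cast hm
    have hp : 0 < (m : ℝ) ^ b := Real.rpow_pos_of_pos hm' b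
    rw [le_div_iff₀ hp]
    refine le_trans ?_ (sum_rpow_bounds hb hb1 m).1
    have : (m : ℝ) ^ b ≤ ((m : ℝ) + 1) ^ b := by gcongr; linarith
    calc _ = ((m : ℝ) ^ b - 1) / b := by field_simp
      _ ≤ _ := by gcongr
  · filter_upwards [eventually_gt_atTop 0] with m hm
    have hm' : (0 : ℝ) < m := by exact_mod_cast hm
    have hp : 0 < (m : ℝ) ^ b := Real.rpow_pos_of_pos hm' b
    rw [div_le_iff₀ hp]
    refine (sum_rpow_bounds hb hb1 m).2.trans_eq (by ring)

/-- The partial sums `∑_{i ≤ m} i ^ (1/q - 1)` of the Lorentz weights. -/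
def lorentzWeightSum (q : ℝ) (m : ℕ) : ℝ := ∑ i ∈ range m, ((i : ℝ) + 1) ^ (1 / q - 1)

/-- The sums `∑_{i ≤ m} 1 / W_i`, where `W_i` are the partial sums of the Lorentz weights. -/
def invWeightSum (q : ℝ) (m : ℕ) : ℝ := ∑ i ∈ range m, 1 / lorentzWeightSum q (i + 1)

lemma one_le_lorentzWeightSum (q : ℝ) (m : ℕ) : 1 ≤ lorentzWeightSum q (m + 1) := by
  rw [lorentzWeightSum, sum_range_succ']
  simp only [Nat.cast_zero, zero_add, Real.one_rpow]
  have : 0 ≤ ∑ k ∈ range m, (((k + 1 : ℕ) : ℝ) + 1) ^ (1 / q - 1) :=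
    sum_nonneg fun i _ => by positivity
  linarith

lemma lorentzWeightSum_pos (q : ℝ) {m : ℕ} (hm : 0 < m) : 0 < lorentzWeightSum q m := by
  obtain ⟨k, rfl⟩ := Nat.exists_eq_succ_of_ne_zero hm.ne'
  exact zero_lt_one.trans_le (one_le_lorentzWeightSum q k)

lemma invWeightSum_mono (q : ℝ) : Monotone (invWeightSum q) := by
  intro a b hab
  refine sum_le_sum_of_subset_of_nonneg (range_mono hab) fun i _ _ => ?_
  exact one_div_nonneg.2 (lorentzWeightSum_pos q i.succ_pos).le

lemma invWeightSum_nonneg (q : ℝ) (m : ℕ) : 0 ≤ invWeightSum q m := by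
  simpa [invWeightSum] using invWeightSum_mono q (Nat.zero_le m)

lemma tendsto_lorentzWeightSum_div {q : ℝ} (hq : 1 < q) :
    Tendsto (fun m : ℕ => lorentzWeightSum q m / (m : ℝ) ^ (1 / q)) atTop (nhds q) := by
  have hq0 : 0 < q := by linarith
  have := tendsto_sum_rpow_div (b := 1 / q) (by positivity) (by rw [div_le_one hq0]; exact hq.le)
  simpa [lorentzWeightSum] using this

lemma isLittleO_invWeightSum {q : ℝ} (hq : 1 < q) :
    (fun m : ℕ => invWeightSum q m - 1 / (q - 1) * (m : ℝ) ^ (1 - 1 / q)) =o[atTop]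
      fun m : ℕ => (m : ℝ) ^ (1 - 1 / q) := by
  have hq0 : 0 < q := by linarith
  have hb : 0 < 1 - 1 / q := by
    rw [sub_pos, div_lt_one hq0]; exact hq
  have hb1 : 1 - 1 / q ≤ 1 := by
    have : 0 < 1 / q := by positivity
    linarith
  have hS := tendsto_sum_rpow_div hb hb1
  have hpow : Tendsto (fun m : ℕ => (m : ℝ) ^ (1 - 1 / q)) atTop atTop :=
    (tendsto_rpow_atTop hb).comp tendsto_natCast_atTop_atTop
  set g : ℕ → ℝ := fun i => ((i : ℝ) + 1) ^ (1 - 1 / q - 1) with hg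
  have hgpos : ∀ i, 0 < g i := fun i => by simp only [hg]; positivity
  have hSg : Tendsto (fun m => ∑ i ∈ range m, g i) atTop atTop := by
    have := hS.pos_mul_atTop (by positivity) hpow
    refine this.congr' ?_
    filter_upwards [eventually_gt_atTop 0] with m hm
    have hm' : (0 : ℝ) < m := by exact_mod_cast hm
    have hp : 0 < (m : ℝ) ^ (1 - 1 / q) := Real.rpow_pos_of_pos hm' _
    field_simp
  have ho1 : (fun i : ℕ => 1 / lorentzWeightSum q (i + 1) - 1 / q * g i) =o[atTop] g := by
    rw [Asymptotics.isLittleO_iff_tendsto (fun i hi => absurd hi (hgpos i).ne')]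
    have h1 := ((tendsto_lorentzWeightSum_div hq).comp (tendsto_add_atTop_nat 1)).inv₀ hq0.ne'
    have h2 := h1.sub_const (1 / q)
    rw [show q⁻¹ - 1 / q = 0 by ring] at h2
    refine h2.congr fun i => ?_
    have hW := lorentzWeightSum_pos q i.succ_pos
    have hgi := hgpos i
    have hgi' : g i = (((i + 1 : ℕ) : ℝ) ^ (1 / q))⁻¹ := by
      simp only [hg]
      rw [← Real.rpow_neg (by positivity)]
      push_cast
      congr 1
      ring
    simp only [Function.comp]
    rw [sub_div, mul_div_assoc, div_self hgi.ne', mul_one, hgi']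
    field_simp
  have ho2 := ho1.sum_range (fun i => (hgpos i).le) hSg
  have hO : (fun m : ℕ => ∑ i ∈ range m, g i) =O[atTop] fun m : ℕ => (m : ℝ) ^ (1 - 1 / q) := by
    refine Asymptotics.IsBigO.of_bound (1 / (1 - 1 / q)) (Eventually.of_forall fun m => ?_)
    rw [Real.norm_of_nonneg (sum_nonneg fun i _ => (hgpos i).le),
      Real.norm_of_nonneg (by positivity)]
    exact (sum_rpow_bounds hb hb1 m).2.trans_eq (by ring)
  have ho3 := ho2.trans_isBigO hO
  have ho4 : (fun m : ℕ => 1 / q * ∑ i ∈ range m, g i - 1 / (q - 1) * (m : ℝ) ^ (1 - 1 / q))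
      =o[atTop] fun m : ℕ => (m : ℝ) ^ (1 - 1 / q) := by
    rw [Asymptotics.isLittleO_iff_tendsto' (by
      filter_upwards [eventually_gt_atTop 0] with m hm h
      have hm' : (0 : ℝ) < m := by exact_mod_cast hm
      exact absurd h (Real.rpow_pos_of_pos hm' _).ne')]
    have h2 := (hS.const_mul (1 / q)).sub_const (1 / (q - 1))
    have hq1 : q - 1 ≠ 0 := by linarith
    rw [show 1 / q * (1 / (1 - 1 / q)) - 1 / (q - 1) = 0 by
      rw [show 1 - 1 / q = (q - 1) / q by field_simp]; field_simp; ring] at h2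
    refine h2.congr' ?_
    filter_upwards [eventually_gt_atTop 0] with m hm
    have hm' : (0 : ℝ) < m := by exact_mod_cast hm
    have hp : 0 < (m : ℝ) ^ (1 - 1 / q) := Real.rpow_pos_of_pos hm' _
    rw [sub_div, mul_div_assoc, mul_div_assoc, div_self hp.ne', mul_one]
  refine (ho3.add ho4).congr_left fun m => ?_
  simp only [invWeightSum, sum_sub_distrib, mul_sum]
  ring

/-- The closed form of the Lebesgue measure of the unit ball of `ℓ_{q,1}^n`. -/
def lorentzVol (q : ℝ) (n : ℕ) : ℝ := 2 ^ n / ∏ i ∈ range n, lorentzWeightSum q (i + 1)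

lemma lorentzVol_pos (q : ℝ) (n : ℕ) : 0 < lorentzVol q n :=
  div_pos (by positivity) (prod_pos fun i _ => lorentzWeightSum_pos q i.succ_pos)

lemma tendsto_log_factorial_div :
    Tendsto (fun n : ℕ => Real.log (n.factorial : ℝ) / n - Real.log n) atTop (nhds (-1)) := by
  have h1 : Tendsto (fun n : ℕ => Real.log (Stirling.stirlingSeq n)) atTop
      (nhds (Real.log (√Real.pi))) :=
    Stirling.tendsto_stirlingSeq_sqrt_pi.log (Real.sqrt_pos.2 Real.pi_pos).ne'
  have hinv : Tendsto (fun n : ℕ => ((n : ℝ))⁻¹) atTop (nhds 0) :=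
    tendsto_inv_atTop_zero.comp tendsto_natCast_atTop_atTop
  have h2 := h1.mul hinv
  have h3 : Tendsto (fun n : ℕ => Real.log (n : ℝ) / (n : ℝ)) atTop (nhds 0) :=
    (Real.isLittleO_log_id_atTop.tendsto_div_nhds_zero).comp tendsto_natCast_atTop_atTop
  have h4 := ((h2.add (hinv.const_mul (1 / 2 * Real.log 2))).add (h3.const_mul (1 / 2))).sub_const 1
  simp only [mul_zero, add_zero, zero_sub] at h4
  refine h4.congr' ?_
  filter_upwards [eventually_gt_atTop 0] with n hn
  have hn' : (0 : ℝ) < n := by exact_mod_cast hn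
  rw [Stirling.log_stirlingSeq_formula, Real.log_div hn'.ne' (Real.exp_pos 1).ne', Real.log_exp,
    Real.log_mul two_ne_zero hn'.ne']
  field_simp
  ring

lemma tendsto_lorentzVol_rpow_div {q : ℝ} (hq : 1 < q) :
    Tendsto (fun n : ℕ => lorentzVol q n ^ (-(1 : ℝ) / n) / (n : ℝ) ^ (1 / q)) atTop
      (nhds (q / (2 * Real.exp (1 / q)))) := by
  have hq0 : 0 < q := by linarith
  have hW := ((tendsto_lorentzWeightSum_div hq).comp (tendsto_add_atTop_nat 1)).log hq0.ne'
  have hC := hW.cesaro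
  have hlim := ((hC.add (tendsto_log_factorial_div.const_mul (1 / q))).sub_const (Real.log 2)).rexp
  have hval : Real.exp (Real.log q + 1 / q * -1 - Real.log 2) = q / (2 * Real.exp (1 / q)) := by
    rw [Real.exp_sub, Real.exp_add, Real.exp_log hq0, Real.exp_log two_pos, mul_neg_one,
      Real.exp_neg]
    field_simp
  rw [hval] at hlim
  refine hlim.congr' ?_
  filter_upwards [eventually_gt_atTop 0] with n hn
  have hn' : (0 : ℝ) < n := by exact_mod_cast hn
  have hp : 0 < lorentzVol q n ^ (-(1 : ℝ) / n) / (n : ℝ) ^ (1 / q) :=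
    div_pos (Real.rpow_pos_of_pos (lorentzVol_pos q n) _) (Real.rpow_pos_of_pos hn' _)
  rw [← Real.exp_log hp]
  congr 1
  have hprod : 0 < ∏ i ∈ range n, lorentzWeightSum q (i + 1) :=
    prod_pos fun i _ => lorentzWeightSum_pos q i.succ_pos
  rw [Real.log_div (Real.rpow_pos_of_pos (lorentzVol_pos q n) _).ne'
    (Real.rpow_pos_of_pos hn' _).ne', Real.log_rpow (lorentzVol_pos q n), Real.log_rpow hn',
    lorentzVol, Real.log_div (by positivity) hprod.ne', Real.log_pow,
    Real.log_prod (fun i _ => (lorentzWeightSum_pos q i.succ_pos).ne')]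
  have hfac : Real.log (n.factorial : ℝ) = ∑ i ∈ range n, Real.log ((i + 1 : ℕ) : ℝ) := by
    rw [← Finset.prod_range_add_one_eq_factorial, Nat.cast_prod, Real.log_prod]
    intro i _
    positivity
  have hsum : ∑ i ∈ range n, Real.log (lorentzWeightSum q (i + 1) / ((i + 1 : ℕ) : ℝ) ^ (1 / q))
      = ∑ i ∈ range n, Real.log (lorentzWeightSum q (i + 1))
        - 1 / q * Real.log (n.factorial : ℝ) := by
    rw [hfac, mul_sum, ← sum_sub_distrib]
    refine sum_congr rfl fun i _ => ?_
    have hi : (0 : ℝ) < ((i + 1 : ℕ) : ℝ) := by positivity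
    rw [Real.log_div (lorentzWeightSum_pos q i.succ_pos).ne' (Real.rpow_pos_of_pos hi _).ne',
      Real.log_rpow hi]
  simp only [Function.comp]
  rw [hsum]
  field_simp
  ring

/-- A sequence which is `o(j ^ b)` is uniformly small relative to `n ^ b` on `{0, …, n}`. -/
lemma eventually_forall_le_of_isLittleO {b : ℝ} (hb : 0 < b) {f : ℕ → ℝ}
    (hf : f =o[atTop] fun m : ℕ => (m : ℝ) ^ b) {ε : ℝ} (hε : 0 < ε) :
    ∀ᶠ n : ℕ in atTop, ∀ j ≤ n, |f j| ≤ ε * (n : ℝ) ^ b := by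
  obtain ⟨J, hJ⟩ := eventually_atTop.1 (Asymptotics.isLittleO_iff.1 hf hε)
  have hpow : Tendsto (fun m : ℕ => ε * (m : ℝ) ^ b) atTop atTop :=
    ((tendsto_rpow_atTop hb).comp tendsto_natCast_atTop_atTop).const_mul_atTop hε
  filter_upwards [hpow.eventually_ge_atTop (∑ i ∈ range J, |f i|)] with n hn j hj
  rcases lt_or_ge j J with h | h
  · exact (single_le_sum (f := fun i => |f i|) (fun i _ => abs_nonneg _) (mem_range.2 h)).trans hn
  · have h1 := hJ j h
    rw [Real.norm_eq_abs, Real.norm_of_nonneg (by positivity)] at h1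
    refine h1.trans ?_
    gcongr

lemma tendsto_riemann_sum_of_antitoneOn {f : ℝ → ℝ} (hf : AntitoneOn f (Set.Icc 0 1)) :
    Tendsto (fun n : ℕ => (n : ℝ)⁻¹ * ∑ i ∈ range n, f (i / n)) atTop
      (nhds (∫ t in (0 : ℝ)..1, f t)) := by
  have hinv : Tendsto (fun n : ℕ => ((n : ℝ))⁻¹) atTop (nhds 0) :=
    tendsto_inv_atTop_zero.comp tendsto_natCast_atTop_atTop
  have hup : Tendsto (fun n : ℕ => (∫ t in (0 : ℝ)..1, f t) + (n : ℝ)⁻¹ * (f 0 - f 1)) atTop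
      (nhds (∫ t in (0 : ℝ)..1, f t)) := by
    simpa using (hinv.mul_const (f 0 - f 1)).const_add (∫ t in (0 : ℝ)..1, f t)
  have hmain : ∀ n : ℕ, 0 < n → (∫ t in (0 : ℝ)..1, f t) ≤ (n : ℝ)⁻¹ * ∑ i ∈ range n, f (i / n) ∧
      (n : ℝ)⁻¹ * ∑ i ∈ range n, f (i / n)
        ≤ (∫ t in (0 : ℝ)..1, f t) + (n : ℝ)⁻¹ * (f 0 - f 1) := by
    intro n hn
    have hn' : (0 : ℝ) < n := by exact_mod_cast hn
    have hg : AntitoneOn (fun x : ℝ => f (x / n)) (Set.Icc (0 : ℝ) (0 + (n : ℝ))) := by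
      intro x hx y hy hxy
      rw [zero_add] at hx hy
      refine hf ⟨div_nonneg hx.1 hn'.le, (div_le_one hn').2 hx.2⟩
        ⟨div_nonneg hy.1 hn'.le, (div_le_one hn').2 hy.2⟩ ?_
      gcongr
    have h1 := hg.integral_le_sum
    have h2 := hg.sum_le_integral
    simp only [zero_add] at h1 h2
    rw [intervalIntegral.integral_comp_div (fun x => f x) hn'.ne'] at h1 h2
    rw [zero_div, div_self hn'.ne', smul_eq_mul] at h1 h2
    have h3 := sum_range_sub (fun i : ℕ => f ((i : ℝ) / n)) n
    rw [sum_sub_distrib, Nat.cast_zero, zero_div, div_self hn'.ne'] at h3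
    constructor
    · rw [← mul_le_mul_iff_right₀ hn', ← mul_assoc, mul_inv_cancel₀ hn'.ne', one_mul]
      exact h1
    · rw [← mul_le_mul_iff_right₀ hn', ← mul_assoc, mul_inv_cancel₀ hn'.ne', one_mul, mul_add,
        ← mul_assoc, mul_inv_cancel₀ hn'.ne', one_mul]
      linarith
  refine tendsto_of_tendsto_of_tendsto_of_le_of_le' tendsto_const_nhds hup ?_ ?_
  · filter_upwards [eventually_gt_atTop 0] with n hn using (hmain n hn).1
  · filter_upwards [eventually_gt_atTop 0] with n hn using (hmain n hn).2

lemma integral_rpow_mul_one_sub_rpow {a b : ℝ} (ha : 0 < a) (hb : 0 < b) :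
    ∫ x in (0 : ℝ)..1, x ^ (a - 1) * (1 - x) ^ (b - 1)
      = Real.Gamma a * Real.Gamma b / Real.Gamma (a + b) := by
  have h := ProbabilityTheory.beta_eq_betaIntegralReal a b ha hb
  rw [ProbabilityTheory.beta] at h
  rw [h, Complex.betaIntegral, ← RCLike.re_eq_complex_re,
    intervalIntegral.integral_of_le (by norm_num),
    intervalIntegral.integral_of_le (by norm_num), ← integral_re]
  · refine setIntegral_congr_fun measurableSet_Ioc fun x ⟨hx1, hx2⟩ => ?_
    norm_cast
    rw [← Complex.ofReal_cpow, ← Complex.ofReal_cpow, RCLike.re_to_complex,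
      Complex.re_mul_ofReal, Complex.ofReal_re]
    all_goals linarith
  · have := Complex.betaIntegral_convergent (u := a) (v := b) (by simpa) (by simpa)
    rwa [intervalIntegrable_iff_integrableOn_Ioc_of_le (by simp), IntegrableOn] at this

lemma integral_one_sub_rpow_rpow {p r : ℝ} (hp : 0 < p) (hr : 0 < r) :
    ∫ t in (0 : ℝ)..1, (1 - t ^ (1 / p)) ^ r
      = Real.Gamma (r + 1) * Real.Gamma (1 + p) / Real.Gamma (r + 1 + p) := by
  have h := integral_comp_rpow_Ioi_of_pos
    (g := (Set.Ioc (0 : ℝ) 1).indicator fun t : ℝ => (1 - t ^ (1 / p)) ^ r) hp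
  rw [setIntegral_indicator measurableSet_Ioc, Set.inter_eq_self_of_subset_right
    (fun x hx => hx.1)] at h
  rw [intervalIntegral.integral_of_le zero_le_one, ← h]
  have h2 : ∀ x ∈ Set.Ioi (0 : ℝ), (p * x ^ (p - 1)) •
      (Set.Ioc (0 : ℝ) 1).indicator (fun t : ℝ => (1 - t ^ (1 / p)) ^ r) (x ^ p)
      = (Set.Ioc (0 : ℝ) 1).indicator
        (fun x => p * (x ^ (p - 1) * (1 - x) ^ (r + 1 - 1))) x := by
    intro x hx
    have hx0 : 0 < x := hx
    by_cases hx1 : x ≤ 1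
    · rw [Set.indicator_of_mem (show x ^ p ∈ Set.Ioc (0 : ℝ) 1 from
          ⟨Real.rpow_pos_of_pos hx0 p, Real.rpow_le_one hx0.le hx1 hp.le⟩),
        Set.indicator_of_mem (show x ∈ Set.Ioc (0 : ℝ) 1 from ⟨hx0, hx1⟩),
        ← Real.rpow_mul hx0.le, mul_one_div_cancel hp.ne',
        Real.rpow_one, add_sub_cancel_right, smul_eq_mul, mul_assoc]
    · have : 1 < x ^ p := Real.one_lt_rpow (not_le.1 hx1) hp
      rw [Set.indicator_of_notMem (fun h => this.not_ge h.2),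
        Set.indicator_of_notMem (fun h => hx1 h.2), smul_zero]
  rw [setIntegral_congr_fun measurableSet_Ioi h2, setIntegral_indicator measurableSet_Ioc,
    Set.inter_eq_self_of_subset_right (fun x hx => hx.1), integral_const_mul,
    ← intervalIntegral.integral_of_le zero_le_one,
    integral_rpow_mul_one_sub_rpow hp (by linarith), add_comm 1 p, Real.Gamma_add_one hp.ne',
    show r + 1 + p = p + (r + 1) by ring]
  ring

/-- The `ℓ_r` norm with respect to the normalized counting measure: `n ^ (-1/r) ‖x‖_r`. -/
def normalizedLp (r : ℝ) {n : ℕ} (x : Fin n → ℝ) : ℝ :=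
  (n : ℝ) ^ (-(1 : ℝ) / r) * (∑ i : Fin n, |x i| ^ r) ^ (1 / r)

lemma normalizedLp_nonneg (r : ℝ) {n : ℕ} (x : Fin n → ℝ) : 0 ≤ normalizedLp r x :=
  mul_nonneg (by positivity) (Real.rpow_nonneg (sum_nonneg fun _ _ => by positivity) _)

lemma normalizedLp_eq (r : ℝ) {n : ℕ} (x : Fin n → ℝ) :
    normalizedLp r x = ((n : ℝ)⁻¹ * ∑ i : Fin n, |x i| ^ r) ^ (1 / r) := by
  rw [normalizedLp, Real.mul_rpow (by positivity) (sum_nonneg fun _ _ => by positivity), neg_div,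
    Real.rpow_neg (by positivity), Real.inv_rpow (by positivity)]

lemma normalizedLp_add_le {r : ℝ} (hr : 1 ≤ r) {n : ℕ} (x y : Fin n → ℝ) :
    normalizedLp r (x + y) ≤ normalizedLp r x + normalizedLp r y := by
  simp only [normalizedLp, Pi.add_apply, ← mul_add]
  exact mul_le_mul_of_nonneg_left (Real.Lp_add_le univ x y hr) (by positivity)

lemma normalizedLp_neg (r : ℝ) {n : ℕ} (x : Fin n → ℝ) :
    normalizedLp r (-x) = normalizedLp r x := by
  simp [normalizedLp]

lemma abs_normalizedLp_sub_le {r : ℝ} (hr : 1 ≤ r) {n : ℕ} (x y : Fin n → ℝ) :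
    |normalizedLp r x - normalizedLp r y| ≤ normalizedLp r (x - y) := by
  have h1 := normalizedLp_add_le hr (x - y) y
  have h2 := normalizedLp_add_le hr (y - x) x
  rw [← neg_sub x y, normalizedLp_neg] at h2
  simp only [sub_add_cancel, neg_sub] at h1 h2
  rw [abs_sub_le_iff]
  constructor <;> linarith

lemma normalizedLp_smul {r : ℝ} (hr : 0 < r) {n : ℕ} {c : ℝ} (hc : 0 ≤ c) (x : Fin n → ℝ) :
    normalizedLp r (c • x) = c * normalizedLp r x := by
  simp only [normalizedLp, Pi.smul_apply, smul_eq_mul, abs_mul, abs_of_nonneg hc]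
  simp_rw [Real.mul_rpow hc (abs_nonneg _)]
  rw [← mul_sum, Real.mul_rpow (by positivity) (sum_nonneg fun _ _ => by positivity),
    ← Real.rpow_mul hc, mul_one_div_cancel hr.ne', Real.rpow_one]
  ring

lemma normalizedLp_comp_perm (r : ℝ) {n : ℕ} (x : Fin n → ℝ) (σ : Equiv.Perm (Fin n)) :
    normalizedLp r (x ∘ σ) = normalizedLp r x := by
  simp only [normalizedLp, Function.comp]
  rw [Equiv.sum_comp σ fun i => |x i| ^ r]

lemma normalizedLp_abs (r : ℝ) {n : ℕ} (x : Fin n → ℝ) :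
    normalizedLp r (fun i => |x i|) = normalizedLp r x := by
  simp [normalizedLp]

lemma normalizedLp_le_of_mean_le {r : ℝ} (hr : 0 < r) {n : ℕ} {x : Fin n → ℝ} {ε : ℝ}
    (hε : 0 ≤ ε) (h : (n : ℝ)⁻¹ * ∑ i : Fin n, |x i| ^ r ≤ ε ^ r) : normalizedLp r x ≤ ε := by
  rw [normalizedLp_eq]
  calc _ ≤ (ε ^ r) ^ (1 / r) :=
        Real.rpow_le_rpow (mul_nonneg (by positivity) (sum_nonneg fun _ _ => by positivity)) h
          (by positivity)
    _ = ε := by rw [← Real.rpow_mul hε, mul_one_div_cancel hr.ne', Real.rpow_one]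

lemma normalizedLp_le_of_abs_le {r : ℝ} (hr : 0 < r) {n : ℕ} {x : Fin n → ℝ} {ε : ℝ}
    (hε : 0 ≤ ε) (h : ∀ i, |x i| ≤ ε) : normalizedLp r x ≤ ε := by
  refine normalizedLp_le_of_mean_le hr hε ?_
  have h1 : ∑ i : Fin n, |x i| ^ r ≤ ∑ i : Fin n, ε ^ r :=
    sum_le_sum fun i _ => Real.rpow_le_rpow (abs_nonneg _) (h i) hr.le
  rw [sum_const, card_univ, Fintype.card_fin, nsmul_eq_mul] at h1
  rcases Nat.eq_zero_or_pos n with rfl | hn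
  · simp; positivity
  · have hn' : (0 : ℝ) < n := by exact_mod_cast hn
    exact (inv_mul_le_iff₀ hn').2 h1

/-- For uniformly bounded vectors, a small mean square forces a small normalized `ℓ_r` norm. -/
lemma exists_normalizedLp_le_of_meanSq_le {r : ℝ} (hr : 0 < r) {M ε : ℝ} (hM : 0 ≤ M)
    (hε : 0 < ε) : ∃ η > 0, ∀ (n : ℕ) (x : Fin n → ℝ), (∀ i, |x i| ≤ M) →
      (n : ℝ)⁻¹ * ∑ i : Fin n, x i ^ 2 ≤ η → normalizedLp r x ≤ ε := by
  set δ : ℝ := ε * (1 / 2) ^ (1 / r) with hδdef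
  have hδ : 0 < δ := by positivity
  have hδr : δ ^ r = ε ^ r / 2 := by
    rw [hδdef, Real.mul_rpow hε.le (by positivity), ← Real.rpow_mul (by norm_num),
      one_div_mul_cancel hr.ne', Real.rpow_one]
    ring
  have hMr : 0 ≤ M ^ r := Real.rpow_nonneg hM r
  refine ⟨ε ^ r / 2 * δ ^ 2 / (M ^ r + 1), by positivity, fun n x hx hq => ?_⟩
  refine normalizedLp_le_of_mean_le hr hε.le ?_
  have hpt : ∀ i, |x i| ^ r ≤ ε ^ r / 2 + M ^ r / δ ^ 2 * x i ^ 2 := by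
    intro i
    rcases le_or_gt |x i| δ with h | h
    · have h1 := Real.rpow_le_rpow (abs_nonneg _) h hr.le
      rw [hδr] at h1
      have : 0 ≤ M ^ r / δ ^ 2 * x i ^ 2 := by positivity
      linarith
    · have h1 := Real.rpow_le_rpow (abs_nonneg _) (hx i) hr.le
      have h2 : δ ^ 2 ≤ x i ^ 2 := by
        rw [← sq_abs (x i)]; gcongr
      have h3 : M ^ r ≤ M ^ r / δ ^ 2 * x i ^ 2 := by
        rw [div_mul_eq_mul_div, le_div_iff₀ (by positivity)]
        gcongr
      have : 0 < ε ^ r := by positivity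
      linarith
  rcases Nat.eq_zero_or_pos n with rfl | hn
  · simp; positivity
  have hn' : (0 : ℝ) < n := by exact_mod_cast hn
  have h1 : (n : ℝ)⁻¹ * ∑ i : Fin n, |x i| ^ r
      ≤ (n : ℝ)⁻¹ * ∑ i : Fin n, (ε ^ r / 2 + M ^ r / δ ^ 2 * x i ^ 2) :=
    mul_le_mul_of_nonneg_left (sum_le_sum fun i _ => hpt i) (by positivity)
  have h2 : (n : ℝ)⁻¹ * ∑ i : Fin n, (ε ^ r / 2 + M ^ r / δ ^ 2 * x i ^ 2)
      = ε ^ r / 2 + M ^ r / δ ^ 2 * ((n : ℝ)⁻¹ * ∑ i : Fin n, x i ^ 2) := by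
    rw [sum_add_distrib, sum_const, card_univ, Fintype.card_fin, nsmul_eq_mul, ← mul_sum]
    field_simp
  have h3 : M ^ r / δ ^ 2 * ((n : ℝ)⁻¹ * ∑ i : Fin n, x i ^ 2) ≤ ε ^ r / 2 := by
    calc _ ≤ M ^ r / δ ^ 2 * (ε ^ r / 2 * δ ^ 2 / (M ^ r + 1)) := by gcongr
      _ = ε ^ r / 2 * (M ^ r / (M ^ r + 1)) := by field_simp
      _ ≤ ε ^ r / 2 * 1 := by
          gcongr
          rw [div_le_one (by positivity)]
          linarith
      _ = _ := mul_one _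
  linarith

/-- The deterministic profile of the increasing rearrangement of `|x|` for `x` on the unit sphere
of `ℓ_{q,1}^n`. -/
def lorentzProfile (q : ℝ) (n : ℕ) (k : Fin n) : ℝ :=
  (n : ℝ)⁻¹ * (invWeightSum q n - invWeightSum q (n - 1 - k))

lemma lorentzProfile_nonneg (q : ℝ) (n : ℕ) (k : Fin n) : 0 ≤ lorentzProfile q n k :=
  mul_nonneg (by positivity) (sub_nonneg.2 (invWeightSum_mono q (by omega)))

/-- The rescaled profiles converge uniformly to their limit. -/
lemma eventually_forall_abs_lorentzProfile_sub_le {q : ℝ} (hq : 1 < q) {ε : ℝ} (hε : 0 < ε) :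
    ∀ᶠ n : ℕ in atTop, ∀ k : Fin n,
      |lorentzVol q n ^ (-(1 : ℝ) / n) * lorentzProfile q n k
        - 1 / (2 * Real.exp (1 / q)) * (q / (q - 1)) *
          (1 - (((n - 1 - k : ℕ) : ℝ) / n) ^ (1 - 1 / q))| ≤ ε := by
  have hq0 : 0 < q := by linarith
  have hq1 : 0 < q - 1 := by linarith
  have hb : 0 < 1 - 1 / q := by
    rw [sub_pos, div_lt_one hq0]; exact hq
  set a : ℝ := q / (2 * Real.exp (1 / q)) with ha
  have ha0 : 0 < a := by positivity
  set κ : ℝ := 1 / (q - 1) with hκ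
  have hκ0 : 0 < κ := by positivity
  set ε₁ : ℝ := ε / (4 * (a + 1)) with hε₁
  have hε₁0 : 0 < ε₁ := by positivity
  set ε₂ : ℝ := min 1 (ε / (2 * κ)) with hε₂
  have hε₂0 : 0 < ε₂ := by positivity
  filter_upwards [eventually_forall_le_of_isLittleO hb (isLittleO_invWeightSum hq) hε₁0,
    (tendsto_lorentzVol_rpow_div hq).eventually (Metric.ball_mem_nhds _ hε₂0),
    eventually_gt_atTop 0] with n h1 h2 hn k
  have hn' : (0 : ℝ) < n := by exact_mod_cast hn
  rw [Real.dist_eq] at h2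
  set c : ℝ := lorentzVol q n ^ (-(1 : ℝ) / n) / (n : ℝ) ^ (1 / q) with hc
  have hc0 : 0 ≤ c := div_nonneg (Real.rpow_nonneg (lorentzVol_pos q n).le _) (by positivity)
  have hca : c ≤ a + 1 := by
    have := (abs_lt.1 h2).2
    have := min_le_left 1 (ε / (2 * κ))
    linarith
  set j : ℕ := n - 1 - k with hj
  have hjn : j ≤ n := by omega
  have hp : 0 < (n : ℝ) ^ (1 - 1 / q) := Real.rpow_pos_of_pos hn' _
  have hpa : 0 < (n : ℝ) ^ (1 / q) := Real.rpow_pos_of_pos hn' _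
  have hnn : (n : ℝ) = (n : ℝ) ^ (1 / q) * (n : ℝ) ^ (1 - 1 / q) := by
    rw [← Real.rpow_add hn']; simp
  set t : ℝ := ((j : ℝ) / n) ^ (1 - 1 / q) with ht
  have ht0 : 0 ≤ t := by positivity
  have ht1 : t ≤ 1 := Real.rpow_le_one (by positivity)
    ((div_le_one hn').2 (by exact_mod_cast hjn)) hb.le
  have htj : (j : ℝ) ^ (1 - 1 / q) = t * (n : ℝ) ^ (1 - 1 / q) := by
    rw [ht, Real.div_rpow (by positivity) hn'.le]; field_simp
  set e : ℝ := ((invWeightSum q n - κ * (n : ℝ) ^ (1 - 1 / q))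
    - (invWeightSum q j - κ * (j : ℝ) ^ (1 - 1 / q))) / (n : ℝ) ^ (1 - 1 / q) with he
  have he' : |e| ≤ 2 * ε₁ := by
    rw [he, abs_div, abs_of_pos hp, div_le_iff₀ hp]
    refine (abs_sub _ _).trans ?_
    linarith [h1 n le_rfl, h1 j hjn]
  have hmain : lorentzVol q n ^ (-(1 : ℝ) / n) * lorentzProfile q n k
      = c * (κ * (1 - t) + e) := by
    rw [he, htj, hc, lorentzProfile, ← hj]
    have : (n : ℝ)⁻¹ = ((n : ℝ) ^ (1 / q) * (n : ℝ) ^ (1 - 1 / q))⁻¹ := by rw [← hnn]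
    rw [this]
    field_simp
    ring
  have hconst : 1 / (2 * Real.exp (1 / q)) * (q / (q - 1)) = a * κ := by
    rw [ha, hκ]; field_simp
  rw [hmain, hconst, show c * (κ * (1 - t) + e) - a * κ * (1 - t)
    = (c - a) * (κ * (1 - t)) + c * e by ring]
  refine (abs_add_le _ _).trans ?_
  rw [abs_mul (c - a), abs_mul c, abs_of_nonneg hc0, abs_of_nonneg (show 0 ≤ κ * (1 - t) from
    mul_nonneg hκ0.le (by linarith))]
  have e1 : |c - a| * (κ * (1 - t)) ≤ ε / 2 := by
    calc _ ≤ (ε / (2 * κ)) * (κ * 1) := by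
          refine mul_le_mul (h2.le.trans (min_le_right _ _)) ?_
            (mul_nonneg hκ0.le (by linarith)) (by positivity)
          exact mul_le_mul_of_nonneg_left (by linarith) hκ0.le
      _ = ε / 2 := by field_simp
  have e2 : c * |e| ≤ ε / 2 := by
    calc _ ≤ (a + 1) * (2 * ε₁) := by gcongr
      _ = ε / 2 := by rw [hε₁]; field_simp; ring
  linarith

lemma tendsto_normalizedLp_limitProfile {q r : ℝ} (hq : 1 < q) (hr : 0 < r) :
    Tendsto (fun n : ℕ => normalizedLp r fun k : Fin n =>
        1 / (2 * Real.exp (1 / q)) * (q / (q - 1)) *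
          (1 - (((n - 1 - k : ℕ) : ℝ) / n) ^ (1 - 1 / q))) atTop (nhds (mqr q r)) := by
  have hq0 : 0 < q := by linarith
  have hq1 : 0 < q - 1 := by linarith
  have hb : 0 < 1 - 1 / q := by
    rw [sub_pos, div_lt_one hq0]; exact hq
  have hp : 0 < q / (q - 1) := by positivity
  have hanti : AntitoneOn (fun t : ℝ => (1 - t ^ (1 - 1 / q)) ^ r) (Set.Icc 0 1) := by
    intro x hx y hy hxy
    refine Real.rpow_le_rpow ?_ ?_ hr.le
    · linarith [Real.rpow_le_one hy.1 hy.2 hb.le]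
    · linarith [Real.rpow_le_rpow hx.1 hxy hb.le]
  have h := tendsto_riemann_sum_of_antitoneOn hanti
  have hexp : (1 - 1 / q) = 1 / (q / (q - 1)) := by field_simp
  rw [show (∫ t in (0 : ℝ)..1, (1 - t ^ (1 - 1 / q)) ^ r)
    = ∫ t in (0 : ℝ)..1, (1 - t ^ (1 / (q / (q - 1)))) ^ r by rw [hexp],
    integral_one_sub_rpow_rpow hp hr] at h
  have h2 := (h.rpow_const (p := 1 / r) (Or.inr (by positivity))).const_mul
    (1 / (2 * Real.exp (1 / q)) * (q / (q - 1)))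
  refine h2.congr' ?_
  filter_upwards [eventually_gt_atTop 0] with n hn
  have hn' : (0 : ℝ) < n := by exact_mod_cast hn
  have h3 := normalizedLp_smul hr (c := 1 / (2 * Real.exp (1 / q)) * (q / (q - 1)))
    (by positivity) fun k : Fin n => (1 - (((n - 1 - k : ℕ) : ℝ) / n) ^ (1 - 1 / q))
  refine Eq.trans ?_ h3.symm
  rw [normalizedLp_eq, Fin.sum_univ_eq_sum_range
    (fun k : ℕ => |1 - (((n - 1 - k : ℕ) : ℝ) / n) ^ (1 - 1 / q)| ^ r),
    sum_range_reflect (fun k : ℕ => |1 - ((k : ℝ) / n) ^ (1 - 1 / q)| ^ r)]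
  congr 3
  refine sum_congr rfl fun i hi => ?_
  rw [abs_of_nonneg]
  have : (i : ℝ) ≤ n := by exact_mod_cast (mem_range.1 hi).le
  linarith [Real.rpow_le_one (div_nonneg i.cast_nonneg hn'.le) ((div_le_one hn').2 this) hb.le]

lemma tendsto_normalizedLp_lorentzProfile {q r : ℝ} (hq : 1 < q) (hr : 1 < r) :
    Tendsto (fun n : ℕ => normalizedLp r (lorentzVol q n ^ (-(1 : ℝ) / n) • lorentzProfile q n))
      atTop (nhds (mqr q r)) := by
  refine (tendsto_normalizedLp_limitProfile hq (by linarith : 0 < r)).congr_dist ?_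
  rw [Metric.tendsto_nhds]
  intro ε hε
  filter_upwards [eventually_forall_abs_lorentzProfile_sub_le hq (half_pos hε)] with n hn
  rw [Real.dist_0_eq_abs, abs_of_nonneg dist_nonneg, dist_comm, Real.dist_eq]
  refine ((abs_normalizedLp_sub_le hr.le _ _).trans
    (normalizedLp_le_of_abs_le (by linarith) (half_pos hε).le fun k => ?_)).trans_lt
    (half_lt_self hε)
  exact hn k

/-- The rescaled profiles are uniformly bounded. -/
lemma eventually_forall_lorentzProfile_le {q : ℝ} (hq : 1 < q) :
    ∀ᶠ n : ℕ in atTop, ∀ k : Fin n, lorentzVol q n ^ (-(1 : ℝ) / n) * lorentzProfile q n k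
      ≤ 1 / (2 * Real.exp (1 / q)) * (q / (q - 1)) + 1 := by
  have hq1 : 0 < q - 1 := by linarith
  filter_upwards [eventually_forall_abs_lorentzProfile_sub_le hq one_pos] with n hn k
  have h1 := (abs_le.1 (hn k)).2
  have h2 : 0 ≤ (((n - 1 - k : ℕ) : ℝ) / n) ^ (1 - 1 / q) := by positivity
  have h3 : 0 ≤ 1 / (2 * Real.exp (1 / q)) * (q / (q - 1)) := by positivity
  nlinarith

/-- The rescaled second moment bound tends to zero. -/
lemma tendsto_variance_bound {q : ℝ} (hq : 1 < q) :
    Tendsto (fun n : ℕ => (lorentzVol q n ^ (-(1 : ℝ) / n)) ^ 2 * (invWeightSum q n / n ^ 2))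
      atTop (nhds 0) := by
  have hq0 : 0 < q := by linarith
  have hb : 0 < 1 - 1 / q := by
    rw [sub_pos, div_lt_one hq0]; exact hq
  have hV : Tendsto (fun n : ℕ => invWeightSum q n / (n : ℝ) ^ (1 - 1 / q)) atTop
      (nhds (1 / (q - 1))) := by
    have h := (isLittleO_invWeightSum hq).tendsto_div_nhds_zero.add_const (1 / (q - 1))
    rw [zero_add] at h
    refine h.congr' ?_
    filter_upwards [eventually_gt_atTop 0] with n hn
    have hn' : (0 : ℝ) < n := by exact_mod_cast hn
    have hp : 0 < (n : ℝ) ^ (1 - 1 / q) := Real.rpow_pos_of_pos hn' _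
    rw [sub_div, mul_div_assoc, div_self hp.ne', mul_one, sub_add_cancel]
  have hneg : Tendsto (fun n : ℕ => (n : ℝ) ^ (-(1 - 1 / q))) atTop (nhds 0) :=
    (tendsto_rpow_neg_atTop hb).comp tendsto_natCast_atTop_atTop
  have h := (((tendsto_lorentzVol_rpow_div hq).pow 2).mul hV).mul hneg
  rw [mul_zero] at h
  refine h.congr' ?_
  filter_upwards [eventually_gt_atTop 0] with n hn
  have hn' : (0 : ℝ) < n := by exact_mod_cast hn
  have hp : 0 < (n : ℝ) ^ (1 - 1 / q) := Real.rpow_pos_of_pos hn' _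
  have hpa : 0 < (n : ℝ) ^ (1 / q) := Real.rpow_pos_of_pos hn' _
  have hnn : (n : ℝ) = (n : ℝ) ^ (1 / q) * (n : ℝ) ^ (1 - 1 / q) := by
    rw [← Real.rpow_add hn']; simp
  have : (n : ℝ) ^ 2 = ((n : ℝ) ^ (1 / q) * (n : ℝ) ^ (1 - 1 / q)) ^ 2 := by rw [← hnn]
  rw [this, Real.rpow_neg hn'.le]
  field_simp

/-- The non-decreasing rearrangement of `|x|`. -/
def ascAbs {n : ℕ} (x : Fin n → ℝ) (k : Fin n) : ℝ := |x (Tuple.sort (fun j => |x j|) k)|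

lemma ascAbs_eq_comp {n : ℕ} (x : Fin n → ℝ) :
    ascAbs x = (fun j => |x j|) ∘ Tuple.sort (fun j => |x j|) := rfl

lemma ascAbs_monotone {n : ℕ} (x : Fin n → ℝ) : Monotone (ascAbs x) :=
  Tuple.monotone_sort (fun j => |x j|)

lemma ascAbs_nonneg {n : ℕ} (x : Fin n → ℝ) (k : Fin n) : 0 ≤ ascAbs x k := abs_nonneg _

lemma ascAbs_smul {n : ℕ} {s : ℝ} (hs : 0 ≤ s) (x : Fin n → ℝ) :
    ascAbs (s • x) = s • ascAbs x := by
  have h : (fun j => |(s • x) j|) = s • fun j => |x j| := by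
    ext j; simp [abs_mul, abs_of_nonneg hs]
  have hmono : Monotone ((s • fun j => |x j|) ∘ Tuple.sort fun j => |x j|) :=
    fun i j hij => mul_le_mul_of_nonneg_left (ascAbs_monotone x hij) hs
  rw [ascAbs_eq_comp, h, ← Tuple.comp_sort_eq_comp_iff_monotone.2 hmono]
  rfl

lemma measurable_ascAbs {n : ℕ} : Measurable (ascAbs (n := n)) := by
  refine measurable_pi_lambda _ fun k => ?_
  have hsort : ∀ σ : Equiv.Perm (Fin n),
      MeasurableSet {x : Fin n → ℝ | σ = Tuple.sort fun j => |x j|} := by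
    intro σ
    simp only [Tuple.eq_sort_iff, Monotone, Function.comp, Set.ofPred_and, Set.ofPred_forall]
    refine MeasurableSet.inter ?_ ?_
    · refine MeasurableSet.iInter fun i => MeasurableSet.iInter fun j => MeasurableSet.iInter
        fun _ => measurableSet_le ?_ ?_ <;> fun_prop
    · refine MeasurableSet.iInter fun i => MeasurableSet.iInter fun j => MeasurableSet.iInter
        fun _ => ?_
      simp only [imp_iff_not_or, Set.ofPred_or]
      refine MeasurableSet.union (measurableSet_eq_fun ?_ ?_).compl (MeasurableSet.const _) <;>
        fun_prop
  have hsum : (fun x : Fin n → ℝ => ascAbs x k) = fun x => ∑ σ : Equiv.Perm (Fin n),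
      {x : Fin n → ℝ | σ = Tuple.sort fun j => |x j|}.indicator (fun x => |x (σ k)|) x := by
    ext x
    rw [Fintype.sum_eq_single (Tuple.sort fun j => |x j|)]
    · rw [Set.indicator_of_mem (by simp)]; rfl
    · intro σ hσ
      rw [Set.indicator_of_notMem (by simpa using hσ)]
  rw [hsum]
  refine Finset.measurable_sum _ fun σ _ => Measurable.indicator ?_ (hsort σ)
  fun_prop

lemma map_abs_volume :
    Measure.map (fun t : ℝ => |t|) volume = (2 : ℝ≥0∞) • volume.restrict (Set.Ici 0) := by
  ext s hs
  have hm : Measurable fun t : ℝ => |t| := by fun_prop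
  rw [Measure.map_apply hm hs, Measure.smul_apply, Measure.restrict_apply hs,
    ← measure_inter_add_sdiff _ (measurableSet_Ici (a := (0 : ℝ))), smul_eq_mul, two_mul]
  congr 1
  · congr 1
    ext t
    simp only [Set.mem_inter_iff, Set.mem_preimage, Set.mem_Ici]
    refine and_congr_left fun ht => by rw [abs_of_nonneg ht]
  · have h1 : (fun t : ℝ => |t|) ⁻¹' s \ Set.Ici 0 = Neg.neg ⁻¹' (s ∩ Set.Ioi 0) := by
      ext t
      simp only [Set.mem_sdiff, Set.mem_preimage, Set.mem_Ici, not_le, Set.mem_inter_iff,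
        Set.mem_Ioi, neg_pos]
      refine and_congr_left fun ht => by rw [abs_of_neg ht]
    rw [h1, Measure.measure_preimage_neg]
    refine measure_congr (Filter.EventuallyEq.inter (ae_eq_refl _) Ioi_ae_eq_Ici)

lemma map_abs_volume_pi (n : ℕ) :
    Measure.map (fun (x : Fin n → ℝ) i => |x i|) volume
      = (2 : ℝ≥0∞) ^ n • volume.restrict (Set.univ.pi fun _ : Fin n => Set.Ici 0) := by
  have hsf : SigmaFinite (Measure.map (fun t : ℝ => |t|) volume) := by
    rw [map_abs_volume]
    rw [← withDensity_const]
    exact SigmaFinite.withDensity_of_ne_top (by simp)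
  rw [volume_pi, Measure.pi_map_pi (μ := fun _ : Fin n => (volume : Measure ℝ))
    (fun _ => by fun_prop), Measure.restrict_pi_pi]
  refine Measure.pi_eq fun s hs => ?_
  rw [Measure.smul_apply, Measure.pi_pi, map_abs_volume]
  simp [prod_mul_distrib]

lemma ae_injective_abs (n : ℕ) :
    ∀ᵐ x : Fin n → ℝ, Function.Injective fun j => |x j| := by
  have h : ∀ i j : Fin n, i ≠ j → ∀ᵐ x : Fin n → ℝ, |x i| ≠ |x j| := by
    intro i j hij
    have key : ∀ c : ℝ, ∀ᵐ x : Fin n → ℝ, x i ≠ c * x j := by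
      intro c
      let f : (Fin n → ℝ) →ₗ[ℝ] ℝ := LinearMap.proj i - c • LinearMap.proj j
      have h0 : volume ((LinearMap.ker f : Submodule ℝ (Fin n → ℝ)) : Set (Fin n → ℝ)) = 0 := by
        refine Measure.addHaar_submodule _ _ fun htop => ?_
        have hmem : Pi.single i (1 : ℝ) ∈ LinearMap.ker f := by rw [htop]; trivial
        simp [f, hij.symm] at hmem
      rw [ae_iff]
      refine measure_mono_null (fun x hx => ?_) h0
      simp only [ne_eq, not_not, Set.mem_ofPred_eq] at hx
      simp [f, hx]
    filter_upwards [key 1, key (-1)] with x h1 h2 h3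
    rcases abs_eq_abs.1 h3 with h | h
    · exact h1 (by rw [h, one_mul])
    · exact h2 (by rw [h]; ring)
  have h' : ∀ᵐ x : Fin n → ℝ, ∀ i j : Fin n, i ≠ j → |x i| ≠ |x j| := by
    rw [ae_all_iff]; intro i
    rw [ae_all_iff]; intro j
    by_cases hij : i = j
    · simp [hij]
    · filter_upwards [h i j hij] with x hx _ using hx
  filter_upwards [h'] with x hx i j hij
  by_contra hne
  exact hx i j hne hij

/-- The Weyl chamber of non-decreasing nonnegative vectors. -/
def monoCone (n : ℕ) : Set (Fin n → ℝ) := {y | Monotone y ∧ ∀ i, 0 ≤ y i}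

lemma measurableSet_monotone (n : ℕ) : MeasurableSet {y : Fin n → ℝ | Monotone y} := by
  simp only [Monotone, Set.ofPred_forall]
  refine MeasurableSet.iInter fun i => MeasurableSet.iInter fun j => MeasurableSet.iInter
    fun _ => measurableSet_le ?_ ?_ <;> fun_prop

lemma measurableSet_monoCone (n : ℕ) : MeasurableSet (monoCone n) := by
  have h : MeasurableSet {y : Fin n → ℝ | ∀ i, 0 ≤ y i} := by
    simp only [Set.ofPred_forall]
    refine MeasurableSet.iInter fun i => measurableSet_le ?_ ?_ <;> fun_prop
  exact (measurableSet_monotone n).inter h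

lemma lintegral_comp_ascAbs {n : ℕ} {F : (Fin n → ℝ) → ℝ≥0∞} (hF : Measurable F) :
    ∫⁻ x, F (ascAbs x) = (n.factorial : ℝ≥0∞) * (2 ^ n * ∫⁻ y in monoCone n, F y) := by
  set K : (Fin n → ℝ) → ℝ≥0∞ := {y : Fin n → ℝ | Monotone y}.indicator F with hK
  have hKm : Measurable K := hF.indicator (measurableSet_monotone n)
  have habs : Measurable fun (x : Fin n → ℝ) i => |x i| := by fun_prop
  have h1 : ∫⁻ x, F (ascAbs x)
      = ∫⁻ x : Fin n → ℝ, ∑ σ : Equiv.Perm (Fin n), K fun i => |x (σ i)| := by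
    refine lintegral_congr_ae ?_
    filter_upwards [ae_injective_abs n] with x hx
    rw [Fintype.sum_eq_single (Tuple.sort fun j => |x j|)]
    · exact (Set.indicator_of_mem (show ascAbs x ∈ {y : Fin n → ℝ | Monotone y} from
        ascAbs_monotone x) F).symm
    · intro σ hσ
      refine Set.indicator_of_notMem (fun hmono => hσ ?_) F
      have h2 := Tuple.comp_sort_eq_comp_iff_monotone (f := fun j => |x j|) (σ := σ) |>.2 hmono
      exact Equiv.ext fun i => hx (congrFun h2 i)
  have h2 : ∀ σ : Equiv.Perm (Fin n), ∫⁻ x : Fin n → ℝ, K (fun i => |x (σ i)|)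
      = ∫⁻ x : Fin n → ℝ, K fun i => |x i| := by
    intro σ
    have hmp := measurePreserving_arrowCongr' (fun _ : Fin n => (volume : Measure ℝ))
      (fun _ => volume) σ.symm (MeasurableEquiv.refl ℝ) fun _ => MeasurePreserving.id _
    have := hmp.lintegral_comp (f := fun x => K fun i => |x i|) (hKm.comp habs)
    rw [volume_pi, ← this]
    rfl
  have h3 : ∫⁻ x : Fin n → ℝ, K (fun i => |x i|) = 2 ^ n * ∫⁻ y in monoCone n, F y := by
    rw [← lintegral_map (f := K) hKm habs, map_abs_volume_pi, lintegral_smul_measure, smul_eq_mul,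
      hK, setLIntegral_indicator (measurableSet_monotone n)]
    congr 3
    ext y
    simp [monoCone, Pi.le_def]
  rw [h1, lintegral_finsetSum _ fun σ _ => ?_]
  · simp_rw [h2, h3]
    rw [sum_const, card_univ, Fintype.card_perm, Fintype.card_fin, nsmul_eq_mul]
  · exact hKm.comp (by fun_prop)

/-- The linear map `z ↦ (∑_{j ≤ k} d_j z_j)_k`. -/
def cumulative {n : ℕ} (d : Fin n → ℝ) : (Fin n → ℝ) →ₗ[ℝ] (Fin n → ℝ) :=
  Matrix.toLin' (Matrix.of fun k j => if j ≤ k then d j else 0)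

lemma cumulative_apply {n : ℕ} (d z : Fin n → ℝ) (k : Fin n) :
    cumulative d z k = ∑ j, (if j ≤ k then d j else 0) * z j := by
  simp [cumulative, Matrix.mulVec, dotProduct]

lemma det_cumulative {n : ℕ} (d : Fin n → ℝ) : LinearMap.det (cumulative d) = ∏ j, d j := by
  rw [cumulative, LinearMap.det_toLin', Matrix.det_of_isLowerTriangular]
  · simp
  · intro i j hij
    have : i < j := hij
    simp [this.not_ge]

lemma cumulative_mem_monoCone_iff {n : ℕ} {d : Fin n → ℝ} (hd : ∀ j, 0 < d j) (z : Fin n → ℝ) :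
    cumulative d z ∈ monoCone n ↔ ∀ j, 0 ≤ z j := by
  have hform : ∀ k, cumulative d z k = ∑ j ∈ univ.filter (· ≤ k), d j * z j := by
    intro k
    rw [cumulative_apply, sum_filter]
    refine sum_congr rfl fun j _ => ?_
    split_ifs <;> simp
  constructor
  · rintro ⟨hmono, hpos⟩ k
    have hsplit : cumulative d z k = d k * z k + ∑ j ∈ univ.filter (· < k), d j * z j := by
      have hins : univ.filter (· ≤ k) = insert k (univ.filter (· < k)) := by
        ext j
        simp [le_iff_eq_or_lt]
      rw [hform, hins, sum_insert (by simp)]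
    suffices h : 0 ≤ d k * z k from nonneg_of_mul_nonneg_right h (hd k)
    by_cases hk : (k : ℕ) = 0
    · have : univ.filter (· < k) = (∅ : Finset (Fin n)) := by
        ext j; simp [Fin.lt_def, hk]
      rw [this, sum_empty, add_zero] at hsplit
      rw [← hsplit]; exact hpos k
    · have hlt : (k : ℕ) - 1 < n := by omega
      have hle : (⟨k - 1, hlt⟩ : Fin n) ≤ k := by simp [Fin.le_def]
      have : univ.filter (· < k) = (univ.filter (· ≤ (⟨k - 1, hlt⟩ : Fin n))) := by
        ext j; simp only [mem_filter, mem_univ, true_and, Fin.lt_def, Fin.le_def]; omega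
      rw [this, ← hform] at hsplit
      have := hmono hle
      linarith
  · intro hz
    have hterm : ∀ j, 0 ≤ d j * z j := fun j => mul_nonneg (hd j).le (hz j)
    refine ⟨fun k l hkl => ?_, fun k => ?_⟩
    · rw [hform, hform]
      refine sum_le_sum_of_subset_of_nonneg (fun j hj => ?_) fun j _ _ => hterm j
      simp only [mem_filter, mem_univ, true_and] at hj ⊢
      exact hj.trans hkl
    · rw [hform]; exact sum_nonneg fun j _ => hterm j

lemma setLIntegral_monoCone {n : ℕ} {d : Fin n → ℝ} (hd : ∀ j, 0 < d j)
    {F : (Fin n → ℝ) → ℝ≥0∞} (hF : Measurable F) :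
    ∫⁻ y in monoCone n, F y = ENNReal.ofReal (∏ j, d j) *
      ∫⁻ z in Set.univ.pi fun _ : Fin n => Set.Ici 0, F (cumulative d z) := by
  have hdet : 0 < ∏ j, d j := prod_pos fun j _ => hd j
  have hmap := Measure.map_linearMap_addHaar_eq_smul_addHaar (volume : Measure (Fin n → ℝ))
    (f := cumulative d) (by rw [det_cumulative]; exact hdet.ne')
  have hmeas : Measurable (cumulative d) :=
    (cumulative d).continuous_of_finiteDimensional.measurable
  rw [det_cumulative, abs_of_pos (inv_pos.2 hdet)] at hmap
  have hpre : (cumulative d) ⁻¹' monoCone n = Set.univ.pi fun _ : Fin n => Set.Ici 0 := by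
    ext z
    rw [Set.mem_preimage, cumulative_mem_monoCone_iff hd]
    simp [Pi.le_def]
  rw [← hpre, ← setLIntegral_map (measurableSet_monoCone n) hF hmeas, hmap,
    Measure.restrict_smul, lintegral_smul_measure, smul_eq_mul, ← mul_assoc,
    ← ENNReal.ofReal_mul hdet.le, mul_inv_cancel₀ hdet.ne', ENNReal.ofReal_one, one_mul]

lemma lintegral_exp_neg_mul_pow (m : ℕ) :
    ∫⁻ s in Set.Ioi (0 : ℝ), ENNReal.ofReal (Real.exp (-s)) * ENNReal.ofReal s ^ m
      = (m.factorial : ℝ≥0∞) := by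
  have hint := Real.GammaIntegral_convergent (s := (m : ℝ) + 1) (by positivity)
  have hval := Real.Gamma_eq_integral (s := (m : ℝ) + 1) (by positivity)
  rw [Real.Gamma_nat_eq_factorial] at hval
  have h := ofReal_integral_eq_lintegral_ofReal hint
    ((ae_restrict_mem measurableSet_Ioi).mono fun s hs => mul_nonneg (Real.exp_pos _).le
      (Real.rpow_nonneg (le_of_lt hs) _))
  rw [← hval, ENNReal.ofReal_natCast] at h
  rw [h]
  refine setLIntegral_congr_fun measurableSet_Ioi fun s hs => ?_
  have hs' : 0 ≤ s := le_of_lt hs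
  simp only [add_sub_cancel_right, Real.rpow_natCast]
  rw [ENNReal.ofReal_mul (Real.exp_pos _).le, ENNReal.ofReal_pow hs']

lemma lintegral_Ici_exp_neg (a : ℝ) :
    ∫⁻ s in Set.Ici a, ENNReal.ofReal (Real.exp (-s)) = ENNReal.ofReal (Real.exp (-a)) := by
  rw [setLIntegral_congr Ioi_ae_eq_Ici.symm, ← ofReal_integral_eq_lintegral_ofReal
    (integrableOn_exp_neg_Ioi a) (Eventually.of_forall fun s => (Real.exp_pos _).le),
    integral_exp_neg_Ioi]

lemma lintegral_exp_neg_mul_of_homogeneous {n d : ℕ} {N : (Fin n → ℝ) → ℝ}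
    {H : (Fin n → ℝ) → ℝ≥0∞} (hN : Measurable N) (hN0 : ∀ x, 0 ≤ N x)
    (hNs : ∀ s : ℝ, 0 < s → ∀ x, N (s • x) = s * N x) (hH : Measurable H)
    (hHs : ∀ s : ℝ, 0 < s → ∀ x, H (s • x) = ENNReal.ofReal s ^ d * H x) :
    ∫⁻ x, ENNReal.ofReal (Real.exp (-N x)) * H x
      = ((n + d).factorial : ℝ≥0∞) * ∫⁻ x in {x | N x ≤ 1}, H x := by
  have hball : ∀ s : ℝ, MeasurableSet {x | N x ≤ s} := fun s => measurableSet_le hN measurable_const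
  have hscale : ∀ s : ℝ, 0 < s → ∫⁻ x in {x | N x ≤ s}, H x
      = ENNReal.ofReal s ^ (n + d) * ∫⁻ x in {x | N x ≤ 1}, H x := by
    intro s hs
    have hmap := Measure.map_addHaar_smul (volume : Measure (Fin n → ℝ)) hs.ne'
    have hG : Measurable ({x | N x ≤ s}.indicator H) := hH.indicator (hball s)
    have h1 := lintegral_map (μ := (volume : Measure (Fin n → ℝ))) hG
      (measurable_const_smul s)
    rw [hmap, lintegral_smul_measure, lintegral_indicator (hball s), smul_eq_mul] at h1
    have h2 : ∀ x, {x | N x ≤ s}.indicator H (s • x)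
        = ENNReal.ofReal s ^ d * {x | N x ≤ 1}.indicator H x := by
      intro x
      have hiff : N (s • x) ≤ s ↔ N x ≤ 1 := by
        rw [hNs s hs]; exact mul_le_iff_le_one_right hs
      by_cases hx : N x ≤ 1
      · rw [Set.indicator_of_mem (show s • x ∈ {x | N x ≤ s} from hiff.2 hx),
          Set.indicator_of_mem (show x ∈ {x | N x ≤ 1} from hx), hHs s hs]
      · rw [Set.indicator_of_notMem (show s • x ∉ {x | N x ≤ s} from fun h => hx (hiff.1 h)),
          Set.indicator_of_notMem (show x ∉ {x | N x ≤ 1} from hx), mul_zero]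
    simp_rw [h2] at h1
    rw [lintegral_const_mul _ (hH.indicator (hball 1)), lintegral_indicator (hball 1)] at h1
    have hfin : Module.finrank ℝ (Fin n → ℝ) = n := by simp
    rw [hfin, abs_of_pos (by positivity), ENNReal.ofReal_inv_of_pos (by positivity),
      ENNReal.ofReal_pow hs.le] at h1
    rw [pow_add, mul_assoc, ← h1, ← mul_assoc, ENNReal.mul_inv_cancel, one_mul]
    · exact pow_ne_zero _ (by simpa using hs)
    · exact ENNReal.pow_ne_top ENNReal.ofReal_ne_top
  have hlayer : ∀ x, ENNReal.ofReal (Real.exp (-N x)) * H x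
      = ∫⁻ s in Set.Ioi (0 : ℝ), ENNReal.ofReal (Real.exp (-s)) * {x | N x ≤ s}.indicator H x := by
    intro x
    have h1 : ∀ s : ℝ, ENNReal.ofReal (Real.exp (-s)) * {x | N x ≤ s}.indicator H x
        = (Set.Ici (N x)).indicator (fun s => ENNReal.ofReal (Real.exp (-s))) s * H x := by
      intro s
      by_cases hx : N x ≤ s
      · rw [Set.indicator_of_mem (show x ∈ {x | N x ≤ s} from hx),
          Set.indicator_of_mem (show s ∈ Set.Ici (N x) from hx)]
      · rw [Set.indicator_of_notMem (show x ∉ {x | N x ≤ s} from hx),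
          Set.indicator_of_notMem (show s ∉ Set.Ici (N x) from hx), mul_zero, zero_mul]
    simp_rw [h1]
    rw [setLIntegral_congr Ioi_ae_eq_Ici,
      lintegral_mul_const _ (Measurable.indicator (by fun_prop) measurableSet_Ici),
      setLIntegral_indicator measurableSet_Ici, Set.inter_eq_left.2 (Set.Ici_subset_Ici.2 (hN0 x)),
      lintegral_Ici_exp_neg]
  simp_rw [hlayer]
  rw [lintegral_lintegral_swap]
  · have h2 : ∀ s ∈ Set.Ioi (0 : ℝ), ∫⁻ x, ENNReal.ofReal (Real.exp (-s)) *
        {x | N x ≤ s}.indicator H x = ENNReal.ofReal (Real.exp (-s)) * ENNReal.ofReal s ^ (n + d)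
          * ∫⁻ x in {x | N x ≤ 1}, H x := by
      intro s hs
      rw [lintegral_const_mul _ (hH.indicator (hball s)), lintegral_indicator (hball s),
        hscale s hs, mul_assoc]
    rw [setLIntegral_congr_fun measurableSet_Ioi h2, lintegral_mul_const _ (by fun_prop),
      lintegral_exp_neg_mul_pow]
  · refine Measurable.aemeasurable ?_
    have h3 : (Function.uncurry fun (x : Fin n → ℝ) (s : ℝ) =>
        ENNReal.ofReal (Real.exp (-s)) * {x | N x ≤ s}.indicator H x)
        = fun p => ENNReal.ofReal (Real.exp (-p.2)) *
          {p : (Fin n → ℝ) × ℝ | N p.1 ≤ p.2}.indicator (fun p => H p.1) p := by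
      ext p; rfl
    rw [h3]
    refine Measurable.mul (by fun_prop) (Measurable.indicator (hH.comp measurable_fst) ?_)
    exact measurableSet_le (hN.comp measurable_fst) measurable_snd

lemma integrable_exp_neg_mul_pow (m : ℕ) :
    Integrable (fun t : ℝ => Real.exp (-t) * t ^ m) (volume.restrict (Set.Ici 0)) := by
  have h := Real.GammaIntegral_convergent (s := (m : ℝ) + 1) (by positivity)
  simp only [add_sub_cancel_right, Real.rpow_natCast] at h
  exact (integrableOn_Ici_iff_integrableOn_Ioi).2 h

lemma integral_exp_neg_mul_pow (m : ℕ) :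
    ∫ t in Set.Ici (0 : ℝ), Real.exp (-t) * t ^ m = m.factorial := by
  have h := Real.Gamma_eq_integral (s := (m : ℝ) + 1) (by positivity)
  simp only [add_sub_cancel_right, Real.rpow_natCast, Real.Gamma_nat_eq_factorial] at h
  rw [integral_Ici_eq_integral_Ioi, h]

lemma integrable_prod_exp_neg_mul_pow {n : ℕ} (e : Fin n → ℕ) :
    Integrable (fun z : Fin n → ℝ => ∏ l, Real.exp (-z l) * z l ^ e l)
      (volume.restrict (Set.univ.pi fun _ : Fin n => Set.Ici 0)) := by
  rw [volume_pi, Measure.restrict_pi_pi]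
  exact Integrable.fintype_prod (f := fun l t => Real.exp (-t) * t ^ e l)
    fun l => integrable_exp_neg_mul_pow (e l)

lemma integral_prod_exp_neg_mul_pow {n : ℕ} (e : Fin n → ℕ) :
    ∫ z in Set.univ.pi fun _ : Fin n => Set.Ici (0 : ℝ), ∏ l, Real.exp (-z l) * z l ^ e l
      = ∏ l, ((e l).factorial : ℝ) := by
  rw [volume_pi, Measure.restrict_pi_pi,
    integral_fintype_prod_eq_prod (fun l t => Real.exp (-t) * t ^ e l)]
  simp_rw [integral_exp_neg_mul_pow]

lemma exp_neg_sum_mul_eq_prod {n : ℕ} (z : Fin n → ℝ) (j k : Fin n) :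
    Real.exp (-∑ l, z l) * (z j * z k)
      = ∏ l, Real.exp (-z l) * z l ^ ((if l = j then 1 else 0) + if l = k then 1 else 0) := by
  simp_rw [pow_add, prod_mul_distrib]
  rw [← Real.exp_sum, sum_neg_distrib]
  simp [prod_ite_eq', pow_ite]

lemma prod_factorial_pair {n : ℕ} (j k : Fin n) :
    ∏ l, ((((if l = j then 1 else 0) + if l = k then 1 else 0 : ℕ).factorial : ℕ) : ℝ)
      = if j = k then 2 else 1 := by
  have h : ∀ l, ((((if l = j then 1 else 0) + if l = k then 1 else 0 : ℕ).factorial : ℕ) : ℝ)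
      = if l = j then (if j = k then 2 else 1) else 1 := by
    intro l
    by_cases h1 : l = j
    · subst h1
      by_cases h2 : l = k <;> simp [h2]
    · by_cases h2 : l = k
      · subst h2; simp [h1]
      · simp [h1, h2]
  simp_rw [h]
  simp

lemma lintegral_exp_neg_sum (n : ℕ) :
    ∫⁻ z in Set.univ.pi fun _ : Fin n => Set.Ici (0 : ℝ), ENNReal.ofReal (Real.exp (-∑ j, z j))
      = 1 := by
  have h : ∀ z : Fin n → ℝ, Real.exp (-∑ j, z j) = ∏ l, Real.exp (-z l) * z l ^ 0 := by
    intro z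
    simp [← Real.exp_sum]
  simp_rw [h]
  rw [← ofReal_integral_eq_lintegral_ofReal (integrable_prod_exp_neg_mul_pow fun _ => 0)
    (Eventually.of_forall fun z => prod_nonneg fun l _ => by positivity),
    integral_prod_exp_neg_mul_pow fun _ => 0]
  simp

lemma lintegral_exp_neg_sum_mul_sq {n : ℕ} {b : Fin n → ℝ} (hb : ∑ j, b j = 0) :
    ∫⁻ z in Set.univ.pi fun _ : Fin n => Set.Ici (0 : ℝ),
      ENNReal.ofReal (Real.exp (-∑ j, z j)) * ENNReal.ofReal ((∑ j, b j * z j) ^ 2)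
      = ENNReal.ofReal (∑ j, b j ^ 2) := by
  set e : Fin n → Fin n → Fin n → ℕ :=
    fun j k l => (if l = j then 1 else 0) + if l = k then 1 else 0 with he
  have hexp : ∀ z : Fin n → ℝ, Real.exp (-∑ j, z j) * (∑ j, b j * z j) ^ 2
      = ∑ j, ∑ k, b j * b k * ∏ l, Real.exp (-z l) * z l ^ e j k l := by
    intro z
    rw [sq, sum_mul_sum, mul_sum]
    refine sum_congr rfl fun j _ => ?_
    rw [mul_sum]
    refine sum_congr rfl fun k _ => ?_
    rw [he, ← exp_neg_sum_mul_eq_prod]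
    ring
  have hint : ∀ j k, Integrable (fun z : Fin n → ℝ =>
      b j * b k * ∏ l, Real.exp (-z l) * z l ^ e j k l)
      (volume.restrict (Set.univ.pi fun _ : Fin n => Set.Ici 0)) :=
    fun j k => (integrable_prod_exp_neg_mul_pow (e j k)).const_mul _
  have hval : ∫ z in Set.univ.pi fun _ : Fin n => Set.Ici (0 : ℝ),
      ∑ j, ∑ k, b j * b k * ∏ l, Real.exp (-z l) * z l ^ e j k l = ∑ j, b j ^ 2 := by
    rw [integral_finsetSum _ fun j _ => integrable_finsetSum _ fun k _ => hint j k]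
    simp_rw [integral_finsetSum _ fun k _ => hint _ k, integral_const_mul,
      integral_prod_exp_neg_mul_pow, he, prod_factorial_pair]
    have h1 : ∀ j k, b j * b k * (if j = k then 2 else 1 : ℝ)
        = b j * b k + if j = k then b j * b k else 0 := by
      intro j k; split_ifs <;> ring
    simp_rw [h1, sum_add_distrib, ← mul_sum, hb]
    simp [sq]
  rw [← hval, ofReal_integral_eq_lintegral_ofReal]
  · refine lintegral_congr fun z => ?_
    rw [← hexp, ENNReal.ofReal_mul (Real.exp_pos _).le]
  · exact integrable_finsetSum _ fun j _ => integrable_finsetSum _ fun k _ => hint j k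
  · refine Eventually.of_forall fun z => ?_
    simp only [← hexp]
    positivity

/-- The increments `1 / ∑_{i < n - j} (i + 1)^{1/q-1}` parametrising the Lorentz unit ball. -/
def lorentzStep (q : ℝ) (n : ℕ) (j : Fin n) : ℝ := 1 / lorentzWeightSum q (n - j)

lemma lorentzStep_pos (q : ℝ) {n : ℕ} (j : Fin n) : 0 < lorentzStep q n j :=
  one_div_pos.2 (lorentzWeightSum_pos q (by omega))

lemma lorentzStep_le_one (q : ℝ) {n : ℕ} (j : Fin n) : lorentzStep q n j ≤ 1 := by
  obtain ⟨m, hm⟩ : ∃ m, n - (j : ℕ) = m + 1 := ⟨n - j - 1, by omega⟩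
  rw [lorentzStep, hm, one_div]
  exact inv_le_one_of_one_le₀ (one_le_lorentzWeightSum q m)

lemma prod_lorentzStep (q : ℝ) (n : ℕ) :
    ∏ j, lorentzStep q n j = 1 / ∏ i ∈ range n, lorentzWeightSum q (i + 1) := by
  simp only [lorentzStep]
  rw [Fin.prod_univ_eq_prod_range (fun j => 1 / lorentzWeightSum q (n - j)) n,
    ← prod_range_reflect, one_div, ← prod_inv_distrib]
  refine prod_congr rfl fun j hj => ?_
  rw [mem_range] at hj
  rw [one_div, show n - (n - 1 - j) = j + 1 by omega]

lemma sum_lorentzStep_le (q : ℝ) {n : ℕ} (k : Fin n) :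
    ∑ j, (if j ≤ k then lorentzStep q n j else 0)
      = invWeightSum q n - invWeightSum q (n - 1 - k) := by
  simp only [lorentzStep, invWeightSum, Fin.le_def]
  rw [Fin.sum_univ_eq_sum_range
    (fun j => if j ≤ (k : ℕ) then 1 / lorentzWeightSum q (n - j) else 0) n,
    sum_range_sub_sum_range (by omega), sum_filter, ← sum_range_reflect]
  refine sum_congr rfl fun j hj => ?_
  rw [mem_range] at hj
  rw [show n - (n - 1 - j) = j + 1 by omega]
  exact if_congr (by omega) rfl rfl

lemma sum_lorentzStep (q : ℝ) (n : ℕ) : ∑ j, lorentzStep q n j = invWeightSum q n := by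
  simp only [lorentzStep, invWeightSum]
  rw [Fin.sum_univ_eq_sum_range (fun j => 1 / lorentzWeightSum q (n - j)) n, ← sum_range_reflect]
  refine sum_congr rfl fun j hj => ?_
  rw [mem_range] at hj
  rw [show n - (n - 1 - j) = j + 1 by omega]

/-- The Lorentz functional on non-decreasing nonnegative vectors. -/
def ascNorm (q : ℝ) {n : ℕ} (u : Fin n → ℝ) : ℝ :=
  ∑ i : Fin n, ((i : ℝ) + 1) ^ (1 / q - 1) * u i.rev

lemma lorentzNorm_eq_ascNorm (q : ℝ) {n : ℕ} (x : Fin n → ℝ) :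
    lorentzNorm q x = ascNorm q (ascAbs x) := rfl

lemma ascNorm_cumulative (q : ℝ) {n : ℕ} (z : Fin n → ℝ) :
    ascNorm q (cumulative (lorentzStep q n) z) = ∑ j, z j := by
  simp only [ascNorm, cumulative_apply, mul_sum]
  rw [sum_comm]
  refine sum_congr rfl fun j _ => ?_
  have h : ∑ i : Fin n, ((i : ℝ) + 1) ^ (1 / q - 1) * (if j ≤ i.rev then (1 : ℝ) else 0)
      = lorentzWeightSum q (n - j) := by
    simp only [mul_ite, mul_one, mul_zero, Fin.le_def, Fin.val_rev]
    rw [Fin.sum_univ_eq_sum_range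
      (fun i => if (j : ℕ) ≤ n - (i + 1) then ((i : ℝ) + 1) ^ (1 / q - 1) else 0) n, ← sum_filter,
      lorentzWeightSum]
    refine sum_congr ?_ fun _ _ => rfl
    ext i
    simp only [mem_filter, mem_range]
    omega
  calc ∑ i : Fin n, ((i : ℝ) + 1) ^ (1 / q - 1) *
        ((if j ≤ i.rev then lorentzStep q n j else 0) * z j)
      = ∑ i : Fin n, ((i : ℝ) + 1) ^ (1 / q - 1) * (if j ≤ i.rev then (1 : ℝ) else 0) *
          (lorentzStep q n j * z j) := by
        refine sum_congr rfl fun i _ => ?_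
        split_ifs <;> ring
    _ = z j := by
        rw [← sum_mul, h, lorentzStep, ← mul_assoc, mul_one_div_cancel, one_mul]
        exact (lorentzWeightSum_pos q (by omega)).ne'

lemma measurable_ascNorm (q : ℝ) {n : ℕ} : Measurable (ascNorm q (n := n)) := by
  unfold ascNorm
  fun_prop

lemma measurable_lorentzNorm (q : ℝ) {n : ℕ} : Measurable (lorentzNorm q (n := n)) :=
  (measurable_ascNorm q).comp measurable_ascAbs

lemma lorentzNorm_nonneg (q : ℝ) {n : ℕ} (x : Fin n → ℝ) : 0 ≤ lorentzNorm q x :=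
  sum_nonneg fun _ _ => mul_nonneg (by positivity) (abs_nonneg _)

lemma lorentzNorm_smul (q : ℝ) {n : ℕ} {s : ℝ} (hs : 0 ≤ s) (x : Fin n → ℝ) :
    lorentzNorm q (s • x) = s * lorentzNorm q x := by
  rw [lorentzNorm_eq_ascNorm, lorentzNorm_eq_ascNorm, ascAbs_smul hs, ascNorm, ascNorm, mul_sum]
  refine sum_congr rfl fun i _ => ?_
  rw [Pi.smul_apply, smul_eq_mul]
  ring

lemma lintegral_comp_ascAbs_eq (q : ℝ) {n : ℕ} {F : (Fin n → ℝ) → ℝ≥0∞} (hF : Measurable F) :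
    ∫⁻ x, F (ascAbs x) = ENNReal.ofReal (n.factorial * lorentzVol q n) *
      ∫⁻ z in Set.univ.pi fun _ : Fin n => Set.Ici 0, F (cumulative (lorentzStep q n) z) := by
  rw [lintegral_comp_ascAbs hF, setLIntegral_monoCone (lorentzStep_pos q) hF, prod_lorentzStep,
    lorentzVol, ENNReal.ofReal_mul (by positivity), ENNReal.ofReal_natCast,
    div_eq_mul_one_div (2 ^ n),
    ENNReal.ofReal_mul (by positivity), ENNReal.ofReal_pow (by norm_num)]
  simp only [ENNReal.ofReal_ofNat, mul_assoc]

lemma volume_lorentzBall (q : ℝ) (n : ℕ) :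
    volume (lorentzBall q n) = ENNReal.ofReal (lorentzVol q n) := by
  have hmeas : Measurable fun u : Fin n → ℝ => ENNReal.ofReal (Real.exp (-ascNorm q u)) :=
    (Real.measurable_exp.comp (measurable_ascNorm q).neg).ennreal_ofReal
  have h1 := lintegral_exp_neg_mul_of_homogeneous (d := 0) (H := fun _ => 1)
    (measurable_lorentzNorm q (n := n)) (lorentzNorm_nonneg q)
    (fun s hs => lorentzNorm_smul q hs.le) measurable_const (by simp)
  have h2 := lintegral_comp_ascAbs_eq q hmeas
  simp only [ascNorm_cumulative, lintegral_exp_neg_sum, mul_one, ← lorentzNorm_eq_ascNorm] at h1 h2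
  rw [h2, setLIntegral_one, ENNReal.ofReal_mul (by positivity), ENNReal.ofReal_natCast,
    add_zero] at h1
  exact ((ENNReal.mul_right_inj (by simpa using n.factorial_ne_zero)
    (ENNReal.natCast_ne_top _)).1 h1).symm

lemma sum_sq_lorentzStep_sub_le (q : ℝ) {n : ℕ} (k : Fin n) :
    ∑ j, ((if j ≤ k then lorentzStep q n j else 0) - lorentzProfile q n k) ^ 2
      ≤ invWeightSum q n := by
  have hn : (n : ℝ) ≠ 0 := by have := k.pos; positivity
  have h1 := sum_lorentzStep_le q k
  have h2 : ∑ j, (if j ≤ k then lorentzStep q n j else 0) = n * lorentzProfile q n k := by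
    rw [h1, lorentzProfile, mul_inv_cancel_left₀ hn]
  have h3 : ∑ j, ((if j ≤ k then lorentzStep q n j else 0) - lorentzProfile q n k) ^ 2
      = ∑ j, (if j ≤ k then lorentzStep q n j else 0) ^ 2 - n * lorentzProfile q n k ^ 2 := by
    simp_rw [sub_sq, sum_add_distrib, sum_sub_distrib, ← sum_mul, ← mul_sum, h2]
    simp
    ring
  rw [h3]
  refine (sub_le_self _ (by positivity)).trans ?_
  rw [← sum_lorentzStep]
  refine sum_le_sum fun j _ => ?_
  have h4 := lorentzStep_pos q j
  have h5 := lorentzStep_le_one q j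
  split_ifs
  · nlinarith
  · simpa using h4.le

lemma setLIntegral_lorentzBall_sq_le (q : ℝ) {n : ℕ} (k : Fin n) :
    ∫⁻ x in lorentzBall q n,
        ENNReal.ofReal ((ascAbs x k - lorentzProfile q n k * lorentzNorm q x) ^ 2)
      ≤ ENNReal.ofReal (invWeightSum q n / n ^ 2) * volume (lorentzBall q n) := by
  set m := lorentzProfile q n k with hm
  have hn : 0 < n := k.pos
  set b : Fin n → ℝ := fun j => (if j ≤ k then lorentzStep q n j else 0) - m with hbdef
  have hb : ∑ j, b j = 0 := by
    rw [hbdef, sum_sub_distrib, sum_lorentzStep_le, hm, lorentzProfile]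
    simp
    field_simp
    ring
  have hcum : ∀ z, cumulative (lorentzStep q n) z k - m * ∑ j, z j = ∑ j, b j * z j := by
    intro z
    rw [cumulative_apply, mul_sum, ← sum_sub_distrib]
    exact sum_congr rfl fun j _ => by rw [hbdef]; ring
  have hsq : Measurable fun u : Fin n → ℝ => ENNReal.ofReal ((u k - m * ascNorm q u) ^ 2) :=
    (((measurable_pi_apply k).sub ((measurable_ascNorm q).const_mul m)).pow_const 2).ennreal_ofReal
  have hmeas : Measurable fun u : Fin n → ℝ =>
      ENNReal.ofReal (Real.exp (-ascNorm q u)) * ENNReal.ofReal ((u k - m * ascNorm q u) ^ 2) :=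
    (Real.measurable_exp.comp (measurable_ascNorm q).neg).ennreal_ofReal.mul hsq
  have h1 := lintegral_exp_neg_mul_of_homogeneous (d := 2)
    (H := fun x => ENNReal.ofReal ((ascAbs x k - m * lorentzNorm q x) ^ 2))
    (measurable_lorentzNorm q (n := n)) (lorentzNorm_nonneg q)
    (fun s hs => lorentzNorm_smul q hs.le) (hsq.comp measurable_ascAbs) (by
      intro s hs x
      rw [lorentzNorm_smul q hs.le, ascAbs_smul hs.le, ← ENNReal.ofReal_pow hs.le,
        ← ENNReal.ofReal_mul (by positivity), Pi.smul_apply, smul_eq_mul]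
      congr 1
      ring)
  have h2 := lintegral_comp_ascAbs_eq q hmeas
  simp only [ascNorm_cumulative, hcum, lintegral_exp_neg_sum_mul_sq hb,
    ← lorentzNorm_eq_ascNorm] at h2
  rw [h2] at h1
  have hfac : ((n + 2).factorial : ℝ≥0∞) ≠ 0 := by simpa using (n + 2).factorial_ne_zero
  rw [volume_lorentzBall, ← ENNReal.mul_le_mul_iff_right hfac (ENNReal.natCast_ne_top _)]
  refine h1.symm.le.trans ?_
  have hL := lorentzVol_pos q n
  have hV := invWeightSum_nonneg q n
  rw [← ENNReal.ofReal_mul (by positivity), ← ENNReal.ofReal_mul (by positivity),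
    ← ENNReal.ofReal_natCast, ← ENNReal.ofReal_mul (by positivity)]
  refine ENNReal.ofReal_le_ofReal ?_
  have hf : ((n + 2).factorial : ℝ) = (n + 2) * ((n + 1) * n.factorial) := by
    rw [Nat.factorial_succ, Nat.factorial_succ]; push_cast; ring
  have hn' : (0 : ℝ) < n := by exact_mod_cast hn
  calc (n.factorial * lorentzVol q n) * ∑ j, b j ^ 2
      ≤ (n.factorial * lorentzVol q n) * invWeightSum q n := by
        gcongr
        exact sum_sq_lorentzStep_sub_le q k
    _ ≤ (n.factorial * lorentzVol q n) * invWeightSum q n * ((n + 2) * (n + 1) / n ^ 2) := by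
        refine le_mul_of_one_le_right (by positivity) ?_
        rw [one_le_div (by positivity)]
        nlinarith
    _ = (n + 2).factorial * (invWeightSum q n / n ^ 2 * lorentzVol q n) := by
        rw [hf]; ring

lemma normalizedLp_ascAbs (r : ℝ) {n : ℕ} (x : Fin n → ℝ) :
    normalizedLp r (ascAbs x) = normalizedLp r x := by
  rw [ascAbs_eq_comp, normalizedLp_comp_perm, normalizedLp_abs]

/-- The deviation of the rescaled rearrangement of `x` from the rescaled Lorentz profile. -/
def lorentzDev (q : ℝ) {n : ℕ} (x : Fin n → ℝ) (i : Fin n) : ℝ :=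
  lorentzVol q n ^ (-(1 : ℝ) / n) * (ascAbs x i - lorentzProfile q n i * lorentzNorm q x)

lemma measurable_lorentzDev (q : ℝ) {n : ℕ} (i : Fin n) :
    Measurable fun x : Fin n → ℝ => lorentzDev q x i :=
  (((measurable_pi_apply i).comp measurable_ascAbs).sub
    ((measurable_lorentzNorm q).const_mul _)).const_mul _

/-- Mean square deviation, augmented by the squared deviation at the index `k`. -/
def lorentzEnergy (q : ℝ) {n : ℕ} (k : Fin n) (x : Fin n → ℝ) : ℝ :=
  (n : ℝ)⁻¹ * ∑ i, lorentzDev q x i ^ 2 + lorentzDev q x k ^ 2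

lemma exists_abs_normalizedLp_sub_mqr_le {q r : ℝ} (hq : 1 < q) (hr : 1 < r) {ε : ℝ}
    (hε : 0 < ε) : ∃ η > 0, ∃ δ > 0, δ < 1 ∧ ∀ᶠ n : ℕ in atTop, ∀ k : Fin n, (∀ i, i ≤ k) →
      ∀ x ∈ lorentzBall q n, lorentzEnergy q k x ≤ η → 1 - δ ≤ lorentzNorm q x →
        |normalizedLp r (lorentzVol q n ^ (-(1 : ℝ) / n) • x) - mqr q r| ≤ ε := by
  set K : ℝ := 1 / (2 * Real.exp (1 / q)) * (q / (q - 1)) with hK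
  have hK0 : 0 ≤ K := by
    have hq1 : 0 < q - 1 := by linarith
    positivity
  have hr0 : 0 < r := by linarith
  obtain ⟨η, hη, hsmall⟩ := exists_normalizedLp_le_of_meanSq_le hr0 (M := K + 2) (by linarith)
    (by linarith : 0 < ε / 3)
  set A : ℝ := |mqr q r| + 1 with hA
  have hA0 : 0 < A := by positivity
  refine ⟨min η 1, by positivity, min (ε / (3 * A)) (1 / 2), by positivity,
    (min_le_right _ _).trans_lt (by norm_num), ?_⟩
  have hclose := Metric.tendsto_nhds.1 (tendsto_normalizedLp_lorentzProfile hq hr)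
    (min (ε / 3) 1) (by positivity)
  filter_upwards [hclose, eventually_forall_lorentzProfile_le hq] with n hn hprof k hk x hx hE hN
  set c : ℝ := lorentzVol q n ^ (-(1 : ℝ) / n) with hc
  have hc0 : 0 < c := Real.rpow_pos_of_pos (lorentzVol_pos q n) _
  have hN0 := lorentzNorm_nonneg q x
  have hN1 : lorentzNorm q x ≤ 1 := hx
  set N := lorentzNorm q x with hNdef
  rw [Real.dist_eq] at hn
  set L := normalizedLp r (c • lorentzProfile q n) with hL
  have hL0 : 0 ≤ L := normalizedLp_nonneg _ _
  have hLA : L ≤ A := by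
    have h1 := (abs_lt.1 (hn.trans_le (min_le_right _ _))).2
    have h2 := le_abs_self (mqr q r)
    linarith
  have hmean0 : 0 ≤ (n : ℝ)⁻¹ * ∑ i, lorentzDev q x i ^ 2 := by positivity
  have hmean : (n : ℝ)⁻¹ * ∑ i, lorentzDev q x i ^ 2 ≤ η := by
    have h1 := hE.trans (min_le_left _ _)
    have h2 := sq_nonneg (lorentzDev q x k)
    rw [lorentzEnergy] at h1
    linarith
  have htop : lorentzDev q x k ≤ 1 := by
    have h1 := hE.trans (min_le_right _ _)
    rw [lorentzEnergy] at h1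
    nlinarith
  have hcN : ∀ i, 0 ≤ c * lorentzProfile q n i * N ∧ c * lorentzProfile q n i * N ≤ K + 1 := by
    intro i
    have h1 : 0 ≤ c * lorentzProfile q n i := mul_nonneg hc0.le (lorentzProfile_nonneg q n i)
    exact ⟨mul_nonneg h1 hN0, (mul_le_of_le_one_right h1 hN1).trans (hprof i)⟩
  have hdev : ∀ i, lorentzDev q x i = c * ascAbs x i - c * lorentzProfile q n i * N := by
    intro i; rw [lorentzDev]; ring
  have hbound : ∀ i, |lorentzDev q x i| ≤ K + 2 := by
    intro i
    have h1 := mul_le_mul_of_nonneg_left (ascAbs_monotone x (hk i)) hc0.le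
    have h2 := mul_nonneg hc0.le (ascAbs_nonneg x i)
    have h3 := hcN i
    have h4 := hcN k
    have h5 := hdev k
    rw [abs_le, hdev i]
    constructor <;> linarith
  have hd := hsmall n (lorentzDev q x) hbound hmean
  have hdiff : lorentzDev q x = c • ascAbs x - N • (c • lorentzProfile q n) := by
    ext i
    rw [hdev i]
    simp only [Pi.sub_apply, Pi.smul_apply, smul_eq_mul]
    ring
  have h1 := abs_normalizedLp_sub_le hr.le (c • ascAbs x) (N • (c • lorentzProfile q n))
  rw [← hdiff, normalizedLp_smul hr0 hc0.le (ascAbs x), normalizedLp_ascAbs,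
    ← normalizedLp_smul hr0 hc0.le x, normalizedLp_smul hr0 hN0] at h1
  have h2 : |N * L - L| ≤ ε / 3 := by
    rw [abs_sub_comm, abs_of_nonneg (by nlinarith)]
    calc L - N * L = (1 - N) * L := by ring
      _ ≤ ε / (3 * A) * A := by
          refine mul_le_mul ?_ hLA hL0 (by positivity)
          linarith [min_le_left (ε / (3 * A)) (1 / 2)]
      _ = ε / 3 := by field_simp
  have h3 := hn.le.trans (min_le_left _ _)
  have h4 := abs_sub_le (normalizedLp r (c • x)) (N * L) (mqr q r)
  have h5 := abs_sub_le (N * L) L (mqr q r)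
  linarith

lemma setLIntegral_lorentzDev_sq_le (q : ℝ) {n : ℕ} (k : Fin n) :
    ∫⁻ x in lorentzBall q n, ENNReal.ofReal (lorentzDev q x k ^ 2)
      ≤ ENNReal.ofReal ((lorentzVol q n ^ (-(1 : ℝ) / n)) ^ 2 * (invWeightSum q n / n ^ 2)) *
        volume (lorentzBall q n) := by
  simp only [lorentzDev, mul_pow]
  simp_rw [ENNReal.ofReal_mul (sq_nonneg (lorentzVol q n ^ (-(1 : ℝ) / n)))]
  rw [lintegral_const_mul' _ _ ENNReal.ofReal_ne_top, mul_assoc]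
  gcongr
  exact setLIntegral_lorentzBall_sq_le q k

lemma setLIntegral_lorentzEnergy_le (q : ℝ) {n : ℕ} (k : Fin n) :
    ∫⁻ x in lorentzBall q n, ENNReal.ofReal (lorentzEnergy q k x)
      ≤ 2 * (ENNReal.ofReal ((lorentzVol q n ^ (-(1 : ℝ) / n)) ^ 2 * (invWeightSum q n / n ^ 2)) *
        volume (lorentzBall q n)) := by
  have hn : 0 < (n : ℝ) := by have := k.pos; positivity
  have hm : ∀ i, Measurable fun x : Fin n → ℝ => ENNReal.ofReal (lorentzDev q x i ^ 2) :=
    fun i => ((measurable_lorentzDev q i).pow_const 2).ennreal_ofReal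
  have h : ∀ x : Fin n → ℝ, ENNReal.ofReal (lorentzEnergy q k x)
      = (n : ℝ≥0∞)⁻¹ * ∑ i, ENNReal.ofReal (lorentzDev q x i ^ 2)
        + ENNReal.ofReal (lorentzDev q x k ^ 2) := by
    intro x
    rw [lorentzEnergy, ENNReal.ofReal_add (by positivity) (by positivity),
      ENNReal.ofReal_mul (by positivity), ENNReal.ofReal_inv_of_pos hn, ENNReal.ofReal_natCast,
      ENNReal.ofReal_sum_of_nonneg fun _ _ => by positivity]
  simp_rw [h]
  rw [lintegral_add_right _ (hm k), lintegral_const_mul _ (Finset.measurable_sum _ fun i _ => hm i),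
    lintegral_finsetSum _ fun i _ => hm i, two_mul]
  refine add_le_add ?_ (setLIntegral_lorentzDev_sq_le q k)
  refine (mul_le_mul_right (sum_le_sum fun i _ => setLIntegral_lorentzDev_sq_le q i) _).trans ?_
  rw [sum_const, card_univ, Fintype.card_fin, nsmul_eq_mul, ← mul_assoc, ENNReal.inv_mul_cancel,
    one_mul]
  · simpa using k.pos.ne'
  · exact ENNReal.natCast_ne_top _

lemma volume_lorentzEnergy_ge_le (q : ℝ) {n : ℕ} (k : Fin n) {η : ℝ} (hη : 0 < η) :
    volume {x ∈ lorentzBall q n | η < lorentzEnergy q k x}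
      ≤ 2 * ENNReal.ofReal ((lorentzVol q n ^ (-(1 : ℝ) / n)) ^ 2 * (invWeightSum q n / n ^ 2)) /
        ENNReal.ofReal η * volume (lorentzBall q n) := by
  have hm : Measurable fun x : Fin n → ℝ => ENNReal.ofReal (lorentzEnergy q k x) := by
    refine Measurable.ennreal_ofReal (Measurable.add (Measurable.const_mul ?_ _)
      ((measurable_lorentzDev q k).pow_const 2))
    exact Finset.measurable_sum _ fun i _ => (measurable_lorentzDev q i).pow_const 2
  have h := meas_ge_le_lintegral_div (μ := volume.restrict (lorentzBall q n)) hm.aemeasurable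
    (ε := ENNReal.ofReal η) (by simpa using hη) ENNReal.ofReal_ne_top
  rw [Measure.restrict_apply (measurableSet_le measurable_const hm)] at h
  calc _ ≤ volume ({x | ENNReal.ofReal η ≤ ENNReal.ofReal (lorentzEnergy q k x)}
        ∩ lorentzBall q n) :=
        measure_mono fun x hx => ⟨ENNReal.ofReal_le_ofReal (le_of_lt hx.2), hx.1⟩
    _ ≤ _ := h
    _ ≤ _ := by
        rw [div_eq_mul_inv, div_eq_mul_inv, mul_right_comm, mul_assoc 2]
        gcongr
        exact setLIntegral_lorentzEnergy_le q k

open scoped Pointwise in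
lemma volume_lorentzNorm_le (q : ℝ) (n : ℕ) {s : ℝ} (hs : 0 < s) :
    volume {x : Fin n → ℝ | lorentzNorm q x ≤ s}
      = ENNReal.ofReal (s ^ n) * volume (lorentzBall q n) := by
  have h : {x : Fin n → ℝ | lorentzNorm q x ≤ s} = s • lorentzBall q n := by
    ext x
    rw [Set.mem_smul_set_iff_inv_smul_mem₀ hs.ne', lorentzBall, Set.mem_ofPred_eq,
      Set.mem_ofPred_eq, lorentzNorm_smul q (inv_nonneg.2 hs.le), inv_mul_le_one₀ hs]
  rw [h, Measure.addHaar_smul_of_nonneg _ hs.le]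
  simp

lemma lorentzVol_rpow_pow_mul (q : ℝ) {n : ℕ} (hn : n ≠ 0) :
    (lorentzVol q n ^ (-(1 : ℝ) / n)) ^ n * lorentzVol q n = 1 := by
  have hL := lorentzVol_pos q n
  rw [← Real.rpow_natCast, ← Real.rpow_mul hL.le, div_mul_cancel₀ _ (by exact_mod_cast hn),
    Real.rpow_neg_one, inv_mul_cancel₀ hL.ne']

open scoped Pointwise in
lemma unifOn_volNormLorentzBall_le (q : ℝ) {n : ℕ} (hn : n ≠ 0) {S : Set (Fin n → ℝ)}
    (hS : MeasurableSet S) {t : ℝ≥0∞}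
    (h : volume {x ∈ lorentzBall q n | lorentzVol q n ^ (-(1 : ℝ) / n) • x ∈ S}
      ≤ t * volume (lorentzBall q n)) :
    unifOn (volNormLorentzBall q n) S ≤ t := by
  have hL := lorentzVol_pos q n
  have hD : volNormLorentzBall q n = lorentzVol q n ^ (-(1 : ℝ) / n) • lorentzBall q n := by
    rw [volNormLorentzBall, volume_lorentzBall, ENNReal.toReal_ofReal hL.le]
    rfl
  have hone := lorentzVol_rpow_pow_mul q hn
  set c : ℝ := lorentzVol q n ^ (-(1 : ℝ) / n) with hc
  have hc0 : 0 < c := Real.rpow_pos_of_pos hL _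
  have hvol : ∀ T : Set (Fin n → ℝ), volume (c • T) = ENNReal.ofReal (c ^ n) * volume T := by
    intro T
    rw [Measure.addHaar_smul_of_nonneg _ hc0.le]
    simp
  have hball : ENNReal.ofReal (c ^ n) * volume (lorentzBall q n) = 1 := by
    rw [volume_lorentzBall, ← ENNReal.ofReal_mul (by positivity), hone, ENNReal.ofReal_one]
  have hinter : S ∩ c • lorentzBall q n = c • {x ∈ lorentzBall q n | c • x ∈ S} := by
    ext y
    simp only [Set.mem_inter_iff, Set.mem_smul_set_iff_inv_smul_mem₀ hc0.ne', Set.mem_ofPred_eq,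
      smul_inv_smul₀ hc0.ne', and_comm]
  rw [unifOn, Measure.smul_apply, Measure.restrict_apply hS, hD, hvol, hball, inv_one, one_smul,
    hinter, hvol]
  calc _ ≤ ENNReal.ofReal (c ^ n) * (t * volume (lorentzBall q n)) := by gcongr
    _ = t := by rw [mul_left_comm, hball, mul_one]

lemma measurable_normalizedLp (r : ℝ) {n : ℕ} : Measurable (normalizedLp r (n := n)) := by
  unfold normalizedLp
  fun_prop

/-- Theorem D (`1 < q < ∞`, `1 < r < ∞`): for `X^{(n)}` uniform on the
volume-normalized Lorentz ball `D_{q,1}^n`, the quantity `n^{-1/r} ‖X^{(n)}‖_r`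
converges in probability to `m_{q,r}`. -/
theorem lln_ellr_norm (q : ℝ) (hq : 1 < q) (r : ℝ) (hr : 1 < r)
    {Ω : Type*} [MeasurableSpace Ω] (P : Measure Ω) [IsProbabilityMeasure P]
    (X : (n : ℕ) → Ω → Fin n → ℝ) (hXmeas : ∀ n, Measurable (X n))
    (hX : ∀ n, Measure.map (X n) P = unifOn (volNormLorentzBall q n)) :
    ∀ ε > 0, Tendsto (fun n : ℕ =>
        P {ω | ε < |(n : ℝ) ^ (-(1 : ℝ) / r) * (∑ i : Fin n, |X n ω i| ^ r) ^ (1 / r)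
                    - mqr q r|})
      atTop (nhds 0) := by
  intro ε hε
  obtain ⟨η, hη, δ, hδ, hδ1, hev⟩ := exists_abs_normalizedLp_sub_mqr_le hq hr hε
  set t : ℕ → ℝ≥0∞ := fun n =>
    2 * ENNReal.ofReal ((lorentzVol q n ^ (-(1 : ℝ) / n)) ^ 2 * (invWeightSum q n / n ^ 2)) /
      ENNReal.ofReal η + ENNReal.ofReal ((1 - δ) ^ n) with ht
  have hlim : Tendsto t atTop (nhds 0) := by
    have h1 := ENNReal.tendsto_ofReal (tendsto_variance_bound hq)
    have h2 := ENNReal.tendsto_ofReal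
      (tendsto_pow_atTop_nhds_zero_of_lt_one (by linarith : 0 ≤ 1 - δ) (by linarith))
    rw [ENNReal.ofReal_zero] at h1 h2
    have h3 := ENNReal.Tendsto.div_const
      (ENNReal.Tendsto.const_mul (a := 2) h1 (Or.inr (by simp))) (b := ENNReal.ofReal η)
      (Or.inr (by simpa using hη))
    have h4 := h3.add h2
    rwa [mul_zero, ENNReal.zero_div, zero_add] at h4
  refine tendsto_of_tendsto_of_tendsto_of_le_of_le' tendsto_const_nhds hlim
    (Eventually.of_forall fun _ => zero_le) ?_
  filter_upwards [hev, eventually_gt_atTop 0] with n hn hn0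
  set S : Set (Fin n → ℝ) := {y | ε < |normalizedLp r y - mqr q r|} with hS
  have hSm : MeasurableSet S := measurableSet_lt measurable_const
    (((measurable_normalizedLp r).sub_const _).abs)
  have hP : P {ω | ε < |(n : ℝ) ^ (-(1 : ℝ) / r) * (∑ i : Fin n, |X n ω i| ^ r) ^ (1 / r)
      - mqr q r|} = unifOn (volNormLorentzBall q n) S := by
    rw [← hX n, Measure.map_apply (hXmeas n) hSm]
    rfl
  rw [hP]
  refine unifOn_volNormLorentzBall_le q hn0.ne' hSm ?_
  set k : Fin n := ⟨n - 1, by omega⟩ with hk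
  have hkmax : ∀ i, i ≤ k := fun i => by rw [Fin.le_def]; simp only [hk]; omega
  have hsub : {x ∈ lorentzBall q n | lorentzVol q n ^ (-(1 : ℝ) / n) • x ∈ S}
      ⊆ {x ∈ lorentzBall q n | η < lorentzEnergy q k x} ∪ {x | lorentzNorm q x ≤ 1 - δ} := by
    intro x hx
    by_contra hcon
    rw [Set.mem_union, not_or] at hcon
    refine (not_lt.2 (hn k hkmax x hx.1 ?_ ?_)) hx.2
    · exact not_lt.1 fun h => hcon.1 ⟨hx.1, h⟩
    · exact le_of_lt (not_le.1 hcon.2)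
  refine (measure_mono hsub).trans ((measure_union_le _ _).trans ?_)
  rw [ht, add_mul]
  gcongr
  · exact volume_lorentzEnergy_ge_le q k hη
  · exact (volume_lorentzNorm_le q n (by linarith)).le

end
end

section
/- Let 1 < q < ∞ and for each n let X^{(n)} be uniformly distributed on D_{q,1}^n := vol_n(B_{q,1}^n)^{-1/n} B_{q,1}^n. Then ‖X^{(n)}‖_∞ converges in probability, as n → ∞, to m_{q,∞} := (1/(2 e^{1/q})) · q/(q-1). -/
open MeasureTheory Finset Filter
open scoped ENNReal NNReal

noncomputable section

/-- The weighted sum `∑ i, v i * x_i^*` of the non-increasing rearrangement of `|x|`. -/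
def weightedNorm (v : ℕ → ℝ) {n : ℕ} (x : Fin n → ℝ) : ℝ :=
  ∑ i : Fin n, v i * sortedAbs x i

lemma sortedAbs_eq_comp {n : ℕ} (x : Fin n → ℝ) :
    sortedAbs x = (fun j => |x j|) ∘ (Fin.revPerm.trans (Tuple.sort fun j => |x j|)) := rfl

lemma antitone_sortedAbs {n : ℕ} (x : Fin n → ℝ) : Antitone (sortedAbs x) := fun _ _ hij =>
  Tuple.monotone_sort (fun j => |x j|) (Fin.rev_le_rev.mpr hij)

lemma sortedAbs_eq_of_antitone {n : ℕ} {x : Fin n → ℝ} {σ : Equiv.Perm (Fin n)}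
    (h : Antitone fun i => |x (σ i)|) (i : Fin n) : sortedAbs x i = |x (σ i)| := by
  have := Tuple.unique_antitone (f := fun j => |x j|) (σ := σ)
    (τ := Fin.revPerm.trans (Tuple.sort fun j => |x j|)) h (antitone_sortedAbs x)
  exact (congrFun this i).symm

lemma sortedAbs_smul {n : ℕ} {c : ℝ} (hc : 0 ≤ c) (x : Fin n → ℝ) (i : Fin n) :
    sortedAbs (c • x) i = c * sortedAbs x i := by
  have h : Antitone fun i =>
      |(c • x) ((Fin.revPerm.trans (Tuple.sort fun j => |x j|)) i)| := by
    intro i j hij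
    simp only [Pi.smul_apply, smul_eq_mul, abs_mul]
    exact mul_le_mul_of_nonneg_left (antitone_sortedAbs x hij) (abs_nonneg c)
  rw [sortedAbs_eq_of_antitone h, sortedAbs_eq_comp]
  simp [abs_mul, abs_of_nonneg hc]

lemma sortedAbs_zero {n : ℕ} (hn : 0 < n) (x : Fin n → ℝ) : sortedAbs x ⟨0, hn⟩ = ‖x‖ := by
  apply le_antisymm
  · exact norm_le_pi_norm x _
  · refine (pi_norm_le_iff_of_nonneg (abs_nonneg _)).mpr fun j => ?_
    set τ := Fin.revPerm.trans (Tuple.sort fun j => |x j|) with hτ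
    have h : sortedAbs x (τ.symm j) ≤ sortedAbs x ⟨0, hn⟩ :=
      antitone_sortedAbs x (Nat.zero_le _)
    change |x (τ (τ.symm j))| ≤ _ at h
    rwa [Equiv.apply_symm_apply] at h

lemma weightedNorm_smul {n : ℕ} (v : ℕ → ℝ) {c : ℝ} (hc : 0 ≤ c) (x : Fin n → ℝ) :
    weightedNorm v (c • x) = c * weightedNorm v x := by
  simp only [weightedNorm, sortedAbs_smul hc, Finset.mul_sum]
  exact Finset.sum_congr rfl fun i _ => by ring

lemma weightedNorm_ite {n : ℕ} (hn : 0 < n) (a : ℝ) (x : Fin n → ℝ) :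
    weightedNorm (fun k => if k = 0 then a else 0) x = a * ‖x‖ := by
  rw [weightedNorm, ← sortedAbs_zero hn x, Finset.sum_eq_single (⟨0, hn⟩ : Fin n)]
  · simp
  · intro i _ hi
    have : (i : ℕ) ≠ 0 := fun h => hi (Fin.ext h)
    simp [this]
  · simp

lemma weightedNorm_add {n : ℕ} (v w : ℕ → ℝ) (x : Fin n → ℝ) :
    weightedNorm (fun k => v k + w k) x = weightedNorm v x + weightedNorm w x := by
  simp only [weightedNorm, add_mul, Finset.sum_add_distrib]

/-- The map sending `x` to its consecutive differences `x j - x (j + 1)`, where `x n = 0`. -/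
def gapMap (n : ℕ) : (Fin n → ℝ) →ₗ[ℝ] (Fin n → ℝ) where
  toFun x j := x j - if h : (j : ℕ) + 1 < n then x ⟨j + 1, h⟩ else 0
  map_add' x y := by
    ext j
    by_cases h : (j : ℕ) + 1 < n
    · simp [h]; ring
    · simp [h]
  map_smul' c x := by
    ext j
    by_cases h : (j : ℕ) + 1 < n
    · simp [h]; ring
    · simp [h]

lemma sum_gapMap {n : ℕ} (x : Fin n → ℝ) (i : Fin n) :
    (∑ j : Fin n, if i ≤ j then gapMap n x j else 0) = x i := by
  set f : ℕ → ℝ := fun k => if h : k < n then x ⟨k, h⟩ else 0 with hf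
  have h1 : ∀ j : Fin n, (if i ≤ j then gapMap n x j else 0)
      = (fun k : ℕ => if (i : ℕ) ≤ k then f k - f (k + 1) else 0) j := by
    intro j
    have hj : f j = x j := dif_pos j.2
    simp only [Fin.le_def, hj]
    rfl
  rw [Finset.sum_congr rfl fun j _ => h1 j,
    Fin.sum_univ_eq_sum_range (fun k : ℕ => if (i : ℕ) ≤ k then f k - f (k + 1) else 0) n,
    ← Finset.sum_filter]
  have h2 : (Finset.range n).filter (fun k => (i : ℕ) ≤ k) = Finset.Ico (i : ℕ) n := by
    ext k; simp [and_comm]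
  rw [h2]
  have h3 := Finset.sum_Ico_sub f i.2.le
  have h4 : ∑ k ∈ Finset.Ico (i : ℕ) n, (f k - f (k + 1)) = f i - f n := by
    rw [← neg_sub (f n), ← h3, ← Finset.sum_neg_distrib]
    exact Finset.sum_congr rfl fun k _ => by ring
  rw [h4]
  simp [hf]

lemma gapMap_injective (n : ℕ) : Function.Injective (gapMap n) := by
  intro x y h
  ext i
  rw [← sum_gapMap x, h, sum_gapMap]

lemma sum_mul_eq_sum_gapMap {n : ℕ} (v : ℕ → ℝ) (x : Fin n → ℝ) :
    ∑ i : Fin n, v i * x i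
      = ∑ j : Fin n, (∑ i ∈ Finset.range (j + 1), v i) * gapMap n x j := by
  have h : ∀ j : Fin n, ∑ i ∈ Finset.range ((j : ℕ) + 1), v i
      = ∑ i : Fin n, if i ≤ j then v i else 0 := by
    intro j
    have := Fin.sum_univ_eq_sum_range (fun k : ℕ => if k ≤ (j : ℕ) then v k else 0) n
    simp only [Fin.le_def]
    rw [this, ← Finset.sum_filter]
    congr 1
    ext k
    have := j.2
    simp only [Finset.mem_range, Finset.mem_filter]
    omega
  simp only [h, Finset.sum_mul]
  rw [Finset.sum_comm]
  refine Finset.sum_congr rfl fun i _ => ?_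
  conv_lhs => rw [← sum_gapMap x i, Finset.mul_sum]
  exact Finset.sum_congr rfl fun j _ => by split_ifs <;> simp

lemma pos_of_gapMap_pos {n : ℕ} {x : Fin n → ℝ} (h : ∀ j, 0 < gapMap n x j) (i : Fin n) :
    0 < x i := by
  rw [← sum_gapMap x i]
  refine Finset.sum_pos' (fun j _ => by split_ifs <;> simp [(h j).le]) ⟨i, Finset.mem_univ i, ?_⟩
  simpa using h i

lemma strictAnti_of_gapMap_pos {n : ℕ} {x : Fin n → ℝ} (h : ∀ j, 0 < gapMap n x j) :
    StrictAnti x := by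
  intro i k hik
  rw [← sum_gapMap x i, ← sum_gapMap x k]
  refine Finset.sum_lt_sum (fun j _ => ?_) ⟨i, Finset.mem_univ i, ?_⟩
  · by_cases h1 : k ≤ j
    · simp [h1, hik.le.trans h1]
    · rw [if_neg h1]
      split_ifs <;> simp [(h j).le]
  · simpa [hik.not_ge] using h i

lemma gapMap_pos_of_strictAnti {n : ℕ} {x : Fin n → ℝ} (hx : StrictAnti x)
    (hpos : ∀ i, 0 < x i) (j : Fin n) : 0 < gapMap n x j := by
  by_cases h : (j : ℕ) + 1 < n
  · have : x ⟨j + 1, h⟩ < x j := hx (Fin.lt_def.mpr (Nat.lt_succ_self _))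
    simp [gapMap, h, this]
  · simp [gapMap, h, hpos j]

/-- The signed permutation `x ↦ (i ↦ s (σ i) * x (σ i))`. -/
def signedPerm {n : ℕ} (g : Equiv.Perm (Fin n) × (Fin n → ℤˣ)) :
    (Fin n → ℝ) →ₗ[ℝ] (Fin n → ℝ) where
  toFun x i := ((g.2 (g.1 i) : ℤ) : ℝ) * x (g.1 i)
  map_add' x y := by ext i; simp [mul_add]
  map_smul' c x := by ext i; simp; ring

lemma abs_eq_signedPerm {n : ℕ} {g : Equiv.Perm (Fin n) × (Fin n → ℤˣ)} {x : Fin n → ℝ}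
    {i : Fin n} (h : 0 < signedPerm g x i) : |x (g.1 i)| = signedPerm g x i := by
  have h' : 0 < ((g.2 (g.1 i) : ℤ) : ℝ) * x (g.1 i) := h
  change _ = ((g.2 (g.1 i) : ℤ) : ℝ) * x (g.1 i)
  rcases Int.units_eq_one_or (g.2 (g.1 i)) with hs | hs
  · rw [hs] at h' ⊢; simp at h' ⊢; exact h'.le
  · rw [hs] at h' ⊢; simp at h' ⊢; exact h'.le

lemma signedPerm_injective {n : ℕ} (g : Equiv.Perm (Fin n) × (Fin n → ℤˣ)) :
    Function.Injective (signedPerm g) := by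
  intro x y h
  ext i
  have h' := congrFun h (g.1.symm i)
  simp only [signedPerm, LinearMap.coe_mk, AddHom.coe_mk, Equiv.apply_symm_apply] at h'
  rcases Int.units_eq_one_or (g.2 i) with hs | hs <;> simpa [hs] using h'

/-- The composition of a signed permutation with the difference map. -/
def chamberEquiv {n : ℕ} (g : Equiv.Perm (Fin n) × (Fin n → ℤˣ)) :
    (Fin n → ℝ) ≃ₗ[ℝ] (Fin n → ℝ) :=
  LinearEquiv.ofInjectiveEndo ((gapMap n).comp (signedPerm g))
    ((gapMap_injective n).comp (signedPerm_injective g))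

lemma chamberEquiv_apply {n : ℕ} (g : Equiv.Perm (Fin n) × (Fin n → ℤˣ)) (x : Fin n → ℝ) :
    chamberEquiv g x = gapMap n (signedPerm g x) := rfl

lemma strictAnti_abs_of_chamberEquiv_pos {n : ℕ} {g : Equiv.Perm (Fin n) × (Fin n → ℤˣ)}
    {x : Fin n → ℝ} (h : ∀ j, 0 < chamberEquiv g x j) : StrictAnti fun i => |x (g.1 i)| := by
  have h1 := strictAnti_of_gapMap_pos h
  have h2 := pos_of_gapMap_pos h
  intro i j hij
  simp only [abs_eq_signedPerm (h2 _)]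
  exact h1 hij

lemma eq_of_chamberEquiv_pos {n : ℕ} {g g' : Equiv.Perm (Fin n) × (Fin n → ℤˣ)}
    {x : Fin n → ℝ} (h : ∀ j, 0 < chamberEquiv g x j) (h' : ∀ j, 0 < chamberEquiv g' x j) :
    g = g' := by
  have ha := strictAnti_abs_of_chamberEquiv_pos h
  have ha' := strictAnti_abs_of_chamberEquiv_pos h'
  have hp := pos_of_gapMap_pos h
  have hp' := pos_of_gapMap_pos h'
  have hinj : Function.Injective fun j => |x j| := by
    intro i j hij
    have := ha.injective (a₁ := g.1.symm i) (a₂ := g.1.symm j) (by simpa using hij)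
    simpa using this
  have h1 : g.1 = g'.1 := by
    have := Tuple.unique_antitone (f := fun j => |x j|) ha.antitone ha'.antitone
    ext1 i
    exact hinj (congrFun this i)
  refine Prod.ext h1 (funext fun k => ?_)
  have e := hp (g.1.symm k)
  have e' := hp' (g'.1.symm k)
  simp only [signedPerm, LinearMap.coe_mk, AddHom.coe_mk, Equiv.apply_symm_apply] at e e'
  rcases Int.units_eq_one_or (g.2 k) with hs | hs <;>
  rcases Int.units_eq_one_or (g'.2 k) with hs' | hs' <;> rw [hs] at e ⊢ <;> rw [hs'] at e' ⊢ <;>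
  simp at e e' <;> linarith

lemma weightedNorm_eq_of_chamberEquiv_pos {n : ℕ} {g : Equiv.Perm (Fin n) × (Fin n → ℤˣ)}
    {x : Fin n → ℝ} (v : ℕ → ℝ) (h : ∀ j, 0 < chamberEquiv g x j) :
    weightedNorm v x
      = ∑ j : Fin n, (∑ i ∈ Finset.range (j + 1), v i) * chamberEquiv g x j := by
  rw [chamberEquiv_apply, ← sum_mul_eq_sum_gapMap]
  refine Finset.sum_congr rfl fun i _ => ?_
  rw [sortedAbs_eq_of_antitone (strictAnti_abs_of_chamberEquiv_pos h).antitone,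
    abs_eq_signedPerm (pos_of_gapMap_pos h i)]

lemma exists_chamberEquiv_pos {n : ℕ} {x : Fin n → ℝ} (hx : Function.Injective fun j => |x j|)
    (h0 : ∀ j, x j ≠ 0) : ∃ g, ∀ j, 0 < chamberEquiv g x j := by
  refine ⟨(Fin.revPerm.trans (Tuple.sort fun j => |x j|), fun k => if 0 < x k then 1 else -1), ?_⟩
  have key : signedPerm (Fin.revPerm.trans (Tuple.sort fun j => |x j|),
      fun k => if 0 < x k then 1 else -1) x = sortedAbs x := by
    ext i
    rw [sortedAbs_eq_comp]
    simp only [signedPerm, LinearMap.coe_mk, AddHom.coe_mk, Function.comp]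
    split_ifs with h
    · rw [abs_of_pos h]; simp
    · rw [abs_of_nonpos (not_lt.mp h)]; simp
  intro j
  rw [chamberEquiv_apply, key]
  refine gapMap_pos_of_strictAnti ?_ (fun i => abs_pos.mpr (h0 _)) j
  refine (antitone_sortedAbs x).strictAnti_of_injective ?_
  rw [sortedAbs_eq_comp]
  exact hx.comp (Equiv.injective _)

lemma ae_abs_injective (n : ℕ) :
    ∀ᵐ x : Fin n → ℝ, (Function.Injective fun j => |x j|) ∧ ∀ j, x j ≠ 0 := by
  have key : ∀ φ : (Fin n → ℝ) →ₗ[ℝ] ℝ, φ ≠ 0 → ∀ᵐ x : Fin n → ℝ, φ x ≠ 0 := by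
    intro φ hφ
    have h := Measure.addHaar_submodule (volume : Measure (Fin n → ℝ)) (LinearMap.ker φ)
      (fun h => hφ (LinearMap.ker_eq_top.mp h))
    rw [ae_iff]
    simp only [ne_eq, not_not]
    exact h
  let p : Fin n → (Fin n → ℝ) →ₗ[ℝ] ℝ := fun k => LinearMap.proj k
  have h0 : ∀ᵐ x : Fin n → ℝ, ∀ j, x j ≠ 0 := by
    refine ae_all_iff.mpr fun j => key (LinearMap.proj j) fun h => ?_
    simpa using LinearMap.congr_fun h (Pi.single j 1)
  have h1 : ∀ᵐ x : Fin n → ℝ, ∀ i j, i ≠ j → x i - x j ≠ 0 := by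
    refine ae_all_iff.mpr fun i => ae_all_iff.mpr fun j => ?_
    by_cases hij : i = j
    · simp [hij]
    · filter_upwards [key (p i - p j) fun h => by
        simpa [p, Ne.symm hij] using LinearMap.congr_fun h (Pi.single i 1)] with x hx _ using hx
  have h2 : ∀ᵐ x : Fin n → ℝ, ∀ i j, i ≠ j → x i + x j ≠ 0 := by
    refine ae_all_iff.mpr fun i => ae_all_iff.mpr fun j => ?_
    by_cases hij : i = j
    · simp [hij]
    · filter_upwards [key (p i + p j) fun h => by
        simpa [p, Ne.symm hij] using LinearMap.congr_fun h (Pi.single i 1)] with x hx _ using hx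
  filter_upwards [h0, h1, h2] with x h0 h1 h2
  refine ⟨fun i j hij => ?_, h0⟩
  by_contra hne
  rcases abs_eq_abs.mp hij with h | h
  · exact h1 i j hne (by linarith)
  · exact h2 i j hne (by linarith)

/-- The corner simplex `{z | 0 < z, ∑ z ≤ 1}`. -/
def cornerSimplex (n : ℕ) : Set (Fin n → ℝ) := {z | (∀ j, 0 < z j) ∧ ∑ j, z j ≤ 1}

lemma measurableSet_cornerSimplex (n : ℕ) : MeasurableSet (cornerSimplex n) := by
  have h1 : MeasurableSet {z : Fin n → ℝ | ∀ j, 0 < z j} := by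
    rw [Set.ofPred_forall]
    exact MeasurableSet.iInter fun j => measurableSet_lt measurable_const (measurable_pi_apply j)
  have h2 : MeasurableSet {z : Fin n → ℝ | ∑ j, z j ≤ 1} :=
    measurableSet_le (Finset.measurable_sum _ fun j _ => measurable_pi_apply j) measurable_const
  exact h1.inter h2

lemma volume_weightedNorm_le_one_eq_mul {n : ℕ} (v : ℕ → ℝ)
    (hv : ∀ j : ℕ, 0 < ∑ i ∈ Finset.range (j + 1), v i) :
    volume {x : Fin n → ℝ | weightedNorm v x ≤ 1}
      = ENNReal.ofReal (∏ j : Fin n, ∑ i ∈ Finset.range ((j : ℕ) + 1), v i)⁻¹ *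
        ∑ g : Equiv.Perm (Fin n) × (Fin n → ℤˣ),
          ENNReal.ofReal |LinearMap.det ((chamberEquiv g).symm : (Fin n → ℝ) →ₗ[ℝ] (Fin n → ℝ))| *
            volume (cornerSimplex n) := by
  set V : Fin n → ℝ := fun j => ∑ i ∈ Finset.range ((j : ℕ) + 1), v i with hV
  have hVpos : ∀ j, 0 < V j := fun j => hv j
  have hprod : 0 < ∏ j, V j := Finset.prod_pos fun j _ => hVpos j
  set Δ : Set (Fin n → ℝ) := Matrix.toLin' (Matrix.diagonal V) ⁻¹' cornerSimplex n with hΔ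
  have hdet : LinearMap.det (Matrix.toLin' (Matrix.diagonal V)) = ∏ j, V j := by
    rw [LinearMap.det_toLin', Matrix.det_diagonal]
  have hmemΔ : ∀ y, y ∈ Δ ↔ (∀ j, 0 < y j) ∧ ∑ j, V j * y j ≤ 1 := by
    intro y
    simp only [hΔ, cornerSimplex, Set.mem_preimage, Matrix.toLin'_apply, Set.mem_ofPred_eq,
      Matrix.mulVec_diagonal]
    exact and_congr_left' (forall_congr' fun j => by simp [hVpos j])
  have hvolΔ : volume Δ = ENNReal.ofReal (∏ j, V j)⁻¹ * volume (cornerSimplex n) := by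
    rw [hΔ, Measure.addHaar_preimage_linearMap _ (by rw [hdet]; exact hprod.ne'), hdet,
      abs_of_pos (inv_pos.mpr hprod)]
  have hmeasΔ : MeasurableSet Δ := by
    have : Measurable (Matrix.toLin' (Matrix.diagonal V)) :=
      (LinearMap.continuous_of_finiteDimensional _).measurable
    exact this (measurableSet_cornerSimplex n)
  have hae : {x : Fin n → ℝ | weightedNorm v x ≤ 1} =ᵐ[volume]
      ⋃ g : Equiv.Perm (Fin n) × (Fin n → ℤˣ), chamberEquiv g ⁻¹' Δ := by
    filter_upwards [ae_abs_injective n] with x hx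
    obtain ⟨g, hg⟩ := exists_chamberEquiv_pos hx.1 hx.2
    apply propext
    change weightedNorm v x ≤ 1 ↔ x ∈ ⋃ g, chamberEquiv g ⁻¹' Δ
    simp only [Set.mem_iUnion, Set.mem_preimage, hmemΔ]
    constructor
    · intro h
      exact ⟨g, hg, by rwa [weightedNorm_eq_of_chamberEquiv_pos v hg] at h⟩
    · rintro ⟨g', hg', h⟩
      rwa [weightedNorm_eq_of_chamberEquiv_pos v hg']
  rw [measure_congr hae, measure_iUnion, tsum_fintype, Finset.mul_sum]
  · refine Finset.sum_congr rfl fun g _ => ?_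
    rw [Measure.addHaar_preimage_linearEquiv, hvolΔ]
    ring
  · intro g g' hne
    refine Set.disjoint_left.mpr fun x hx hx' => hne ?_
    exact eq_of_chamberEquiv_pos ((hmemΔ _).mp hx).1 ((hmemΔ _).mp hx').1
  · intro g
    exact (LinearMap.continuous_of_finiteDimensional
      ((chamberEquiv g : (Fin n → ℝ) →ₗ[ℝ] (Fin n → ℝ)))).measurable hmeasΔ

lemma sum_range_ite_zero (a : ℝ) (j : ℕ) :
    ∑ i ∈ Finset.range (j + 1), (if i = 0 then a else 0) = a := by
  simp

lemma volume_weightedNorm_le_one {n : ℕ} (hn : 0 < n) (v : ℕ → ℝ)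
    (hv : ∀ j : ℕ, 0 < ∑ i ∈ Finset.range (j + 1), v i) :
    volume {x : Fin n → ℝ | weightedNorm v x ≤ 1}
      = ENNReal.ofReal (∏ j ∈ Finset.range n, 2 / ∑ i ∈ Finset.range (j + 1), v i) := by
  have h1 := volume_weightedNorm_le_one_eq_mul (n := n) (fun k => if k = 0 then 1 else 0)
    (fun j => by rw [sum_range_ite_zero]; exact one_pos)
  simp only [sum_range_ite_zero, weightedNorm_ite hn, one_mul, Finset.prod_const_one, inv_one,
    ENNReal.ofReal_one] at h1
  have h2 : {x : Fin n → ℝ | ‖x‖ ≤ 1} = Metric.closedBall 0 1 := by ext; simp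
  rw [volume_weightedNorm_le_one_eq_mul v hv, ← h1, h2, Real.volume_pi_closedBall _ zero_le_one,
    Fin.prod_univ_eq_prod_range (fun j => ∑ i ∈ Finset.range (j + 1), v i) n,
    ← ENNReal.ofReal_mul (inv_nonneg.mpr (Finset.prod_nonneg fun j _ => (hv j).le)),
    Finset.prod_div_distrib]
  simp [div_eq_mul_inv, mul_comm]

lemma volume_weightedNorm_le {n : ℕ} (hn : 0 < n) (v : ℕ → ℝ)
    (hv : ∀ j : ℕ, 0 < ∑ i ∈ Finset.range (j + 1), v i) {t : ℝ} (ht : 0 < t) :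
    volume {x : Fin n → ℝ | weightedNorm v x ≤ t}
      = ENNReal.ofReal (∏ j ∈ Finset.range n, 2 * t / ∑ i ∈ Finset.range (j + 1), v i) := by
  have h := volume_weightedNorm_le_one hn (fun k => t⁻¹ * v k)
    (fun j => by rw [← Finset.mul_sum]; exact mul_pos (inv_pos.mpr ht) (hv j))
  have hset : {x : Fin n → ℝ | weightedNorm (fun k => t⁻¹ * v k) x ≤ 1}
      = {x | weightedNorm v x ≤ t} := by
    ext x
    have : weightedNorm (fun k => t⁻¹ * v k) x = t⁻¹ * weightedNorm v x := by
      simp only [weightedNorm, Finset.mul_sum, mul_assoc]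
    simp only [Set.mem_ofPred_eq, this]
    rw [inv_mul_le_iff₀ ht, mul_one]
  rw [hset] at h
  rw [h]
  congr 1
  refine Finset.prod_congr rfl fun j _ => ?_
  rw [← Finset.mul_sum]
  have := (hv j).ne'
  field_simp

/-- The partial sums `∑_{i=1}^{j+1} i^{α-1}` of the Lorentz weights. -/
def weightSum (α : ℝ) (j : ℕ) : ℝ := ∑ i ∈ Finset.range (j + 1), ((i : ℝ) + 1) ^ (α - 1)

lemma one_le_weightSum (α : ℝ) (j : ℕ) : 1 ≤ weightSum α j := by
  have h := Finset.single_le_sum (f := fun i : ℕ => ((i : ℝ) + 1) ^ (α - 1))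
    (s := Finset.range (j + 1)) (fun i _ => by positivity) (Finset.mem_range.mpr (Nat.succ_pos j))
  simpa [weightSum] using h

lemma tendsto_rpow_succ_sub_rpow_div (β : ℝ) :
    Tendsto (fun i : ℕ => (((i : ℝ) + 1) ^ β - (i : ℝ) ^ β) / ((i : ℝ) + 1) ^ (β - 1))
      atTop (nhds β) := by
  have hd : HasDerivAt (fun t : ℝ => t ^ β) β 1 := by
    simpa using Real.hasDerivAt_rpow_const (x := 1) (p := β) (Or.inl one_ne_zero)
  have ht : Tendsto (fun i : ℕ => (i : ℝ) / ((i : ℝ) + 1)) atTop (nhdsWithin 1 {1}ᶜ) := by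
    refine tendsto_nhdsWithin_iff.mpr ⟨tendsto_natCast_div_add_atTop 1, ?_⟩
    refine Eventually.of_forall fun i => ?_
    have : (0 : ℝ) < (i : ℝ) + 1 := by positivity
    simp only [Set.mem_compl_iff, Set.mem_singleton_iff, div_eq_one_iff_eq this.ne']
    linarith
  refine (hd.tendsto_slope.comp ht).congr fun i => ?_
  have h1 : (0 : ℝ) < (i : ℝ) + 1 := by positivity
  have h2 : (i : ℝ) / (i + 1) - 1 = -(1 / ((i : ℝ) + 1)) := by field_simp; ring
  simp only [Function.comp, slope_def_field, Real.one_rpow, h2]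
  rw [Real.div_rpow i.cast_nonneg h1.le, Real.rpow_sub_one h1.ne']
  have := (Real.rpow_pos_of_pos h1 β).ne'
  field_simp
  ring

lemma tendsto_sum_div_rpow {β L : ℝ} (hβ : 0 < β) {a : ℕ → ℝ}
    (ha : Tendsto (fun i : ℕ => a i / ((i : ℝ) + 1) ^ (β - 1)) atTop (nhds L)) :
    Tendsto (fun n : ℕ => (∑ i ∈ Finset.range n, a i) / (n : ℝ) ^ β) atTop (nhds (L / β)) := by
  set g : ℕ → ℝ := fun i => ((i : ℝ) + 1) ^ β - (i : ℝ) ^ β with hg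
  have hgpos : ∀ i, 0 < g i := fun i =>
    sub_pos.mpr (Real.rpow_lt_rpow i.cast_nonneg (lt_add_one _) hβ)
  have hsum : ∀ n : ℕ, ∑ i ∈ Finset.range n, g i = (n : ℝ) ^ β := by
    intro n
    have := Finset.sum_range_sub (fun i : ℕ => (i : ℝ) ^ β) n
    simpa [hg, Real.zero_rpow hβ.ne'] using this
  have hlim : Tendsto (fun i => a i / g i) atTop (nhds (L / β)) := by
    refine (ha.div (tendsto_rpow_succ_sub_rpow_div β) hβ.ne').congr fun i => ?_
    have h1 : (0 : ℝ) < ((i : ℝ) + 1) ^ (β - 1) := by positivity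
    exact div_div_div_cancel_right₀ h1.ne' _ _
  have hlit : (fun i => a i - L / β * g i) =o[atTop] g := by
    refine Asymptotics.isLittleO_of_tendsto (fun i hi => absurd hi (hgpos i).ne') ?_
    have h := hlim.sub_const (L / β)
    rw [sub_self] at h
    refine h.congr fun i => ?_
    have := (hgpos i).ne'
    field_simp
  have hrpow : Tendsto (fun n : ℕ => (n : ℝ) ^ β) atTop atTop :=
    (tendsto_rpow_atTop hβ).comp tendsto_natCast_atTop_atTop
  have hlit2 := hlit.sum_range (fun i => (hgpos i).le) (by simpa only [hsum] using hrpow)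
  simp only [hsum, Finset.sum_sub_distrib, ← Finset.mul_sum] at hlit2
  have h := hlit2.tendsto_div_nhds_zero.add_const (L / β)
  rw [zero_add] at h
  refine h.congr' ?_
  filter_upwards [eventually_gt_atTop 0] with n hn
  have : (0 : ℝ) < (n : ℝ) ^ β := Real.rpow_pos_of_pos (by exact_mod_cast hn) _
  field_simp
  ring

lemma tendsto_weightSum_div {α : ℝ} (hα : 0 < α) :
    Tendsto (fun j : ℕ => weightSum α j / ((j : ℝ) + 1) ^ α) atTop (nhds (1 / α)) := by
  have h := tendsto_sum_div_rpow hα (L := 1) (a := fun i : ℕ => ((i : ℝ) + 1) ^ (α - 1))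
    (tendsto_const_nhds.congr fun i => (div_self (by positivity)).symm)
  simpa [Function.comp_def, weightSum] using h.comp (tendsto_add_atTop_nat 1)

lemma tendsto_sum_inv_weightSum {α : ℝ} (hα : 0 < α) (hα1 : α < 1) :
    Tendsto (fun n : ℕ => (∑ j ∈ Finset.range n, (weightSum α j)⁻¹) / (n : ℝ) ^ (1 - α))
      atTop (nhds (α / (1 - α))) := by
  refine tendsto_sum_div_rpow (by linarith) ?_
  have h := (tendsto_weightSum_div hα).inv₀ (by positivity)
  rw [one_div, inv_inv] at h
  refine h.congr fun i => ?_
  have h1 : (0 : ℝ) ≤ (i : ℝ) + 1 := by positivity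
  rw [show 1 - α - 1 = -α by ring, Real.rpow_neg h1, inv_div, div_inv_eq_mul, div_eq_mul_inv,
    mul_comm]

lemma tendsto_mean_log_weightSum {α : ℝ} (hα : 0 < α) :
    Tendsto (fun n : ℕ => (n : ℝ)⁻¹ * ∑ j ∈ Finset.range n, Real.log (weightSum α j)
      - α * Real.log n) atTop (nhds (Real.log (1 / α) - α)) := by
  set b : ℕ → ℝ := fun i => (i : ℝ) * Real.log i with hb
  have hstep : Tendsto (fun i : ℕ => (i : ℝ) * Real.log (1 + 1 / i)) atTop (nhds 1) :=
    (Real.tendsto_mul_log_one_add_div_atTop 1).comp tendsto_natCast_atTop_atTop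
  have he : Tendsto (fun i : ℕ => Real.log (weightSum α i) - α * (b (i + 1) - b i)) atTop
      (nhds (Real.log (1 / α) - α)) := by
    have h1 := ((tendsto_weightSum_div hα).log (by positivity)).sub (hstep.const_mul α)
    rw [mul_one] at h1
    refine h1.congr' ?_
    filter_upwards [eventually_gt_atTop 0] with i hi
    have hi' : (0 : ℝ) < i := by exact_mod_cast hi
    have hi1 : (0 : ℝ) < (i : ℝ) + 1 := by positivity
    have hW : 0 < weightSum α i := one_pos.trans_le (one_le_weightSum α i)
    rw [Real.log_div hW.ne' (by positivity), Real.log_rpow hi1,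
      show (1 : ℝ) + 1 / i = (i + 1) / i by field_simp, Real.log_div hi1.ne' hi'.ne']
    simp only [hb, Nat.cast_add, Nat.cast_one]
    ring
  refine he.cesaro.congr' ?_
  filter_upwards [eventually_gt_atTop 0] with n hn
  have hn' : (0 : ℝ) < n := by exact_mod_cast hn
  rw [Finset.sum_sub_distrib, ← Finset.mul_sum, Finset.sum_range_sub]
  simp only [hb, Nat.cast_zero, zero_mul, sub_zero]
  field_simp

lemma inv_one_add_le_exp {u : ℝ} (hu : |u| ≤ 1 / 2) :
    (1 + u)⁻¹ ≤ Real.exp (2 * u ^ 2 - u) := by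
  obtain ⟨h1, h2⟩ := abs_le.mp hu
  have hpos : 0 < 1 + u := by linarith
  have hlog := Real.one_sub_inv_le_log_of_pos hpos
  have : u - 2 * u ^ 2 ≤ 1 - (1 + u)⁻¹ := by
    have e : 1 - (1 + u)⁻¹ - (u - 2 * u ^ 2) = u ^ 2 * (1 + 2 * u) / (1 + u) := by
      field_simp; ring
    have : 0 ≤ u ^ 2 * (1 + 2 * u) / (1 + u) :=
      div_nonneg (mul_nonneg (sq_nonneg u) (by linarith)) hpos.le
    linarith
  rw [← Real.exp_log (inv_pos.mpr hpos), Real.log_inv]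
  exact Real.exp_le_exp.mpr (by linarith)

lemma volume_weightedNorm_le_inter_le {n : ℕ} (hn : 0 < n) (α : ℝ) {a s c : ℝ} (hc : 0 < c)
    (hcas : 0 < c + a * s) (ha : |a| ≤ 1 / 2)
    (hvol : ∏ j ∈ Finset.range n, 2 * c / weightSum α j = 1) :
    volume ({x : Fin n → ℝ | a * (‖x‖ - s) ≤ 0} ∩
        {x | weightedNorm (fun k => ((k : ℝ) + 1) ^ (α - 1)) x ≤ c})
      ≤ ENNReal.ofReal (Real.exp (n * (a * s / c)
        + (2 * a ^ 2 - a) * ∑ j ∈ Finset.range n, (weightSum α j)⁻¹)) := by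
  set w : ℕ → ℝ := fun k => ((k : ℝ) + 1) ^ (α - 1)
  set v : ℕ → ℝ := fun k => w k + if k = 0 then a else 0
  have hW : ∀ j, ∑ i ∈ Finset.range (j + 1), v i = weightSum α j + a := fun j => by
    rw [Finset.sum_add_distrib, sum_range_ite_zero]; rfl
  have hle : ∀ j, 1 / 2 ≤ weightSum α j + a := fun j => by
    have := one_le_weightSum α j
    have := (abs_le.mp ha).1
    linarith
  calc _ ≤ volume {x : Fin n → ℝ | weightedNorm v x ≤ c + a * s} := by
        refine measure_mono fun x hx => ?_
        have h1 : a * (‖x‖ - s) ≤ 0 := hx.1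
        have h2 : weightedNorm w x ≤ c := hx.2
        change weightedNorm v x ≤ c + a * s
        rw [weightedNorm_add, weightedNorm_ite hn]
        linarith
    _ = ENNReal.ofReal (∏ j ∈ Finset.range n, 2 * (c + a * s) / (weightSum α j + a)) := by
        rw [volume_weightedNorm_le hn v (fun j => by rw [hW]; linarith [hle j]) hcas]
        simp only [hW]
    _ ≤ _ := by
        refine ENNReal.ofReal_le_ofReal ?_
        have e : Real.exp (n * (a * s / c)
            + (2 * a ^ 2 - a) * ∑ j ∈ Finset.range n, (weightSum α j)⁻¹)
            = ∏ j ∈ Finset.range n, (2 * c / weightSum α j *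
              Real.exp (a * s / c + (2 * a ^ 2 - a) * (weightSum α j)⁻¹)) := by
          rw [Finset.prod_mul_distrib, hvol, one_mul, ← Real.exp_sum, Finset.sum_add_distrib,
            ← Finset.mul_sum]
          simp
        rw [e]
        refine Finset.prod_le_prod (fun j _ => ?_) fun j _ => ?_
        · have := hle j
          positivity
        · have h1 := one_le_weightSum α j
          set W := weightSum α j
          have hWpos : 0 < W := by linarith
          have hWa : 0 < W + a := by linarith [hle j]
          have e1 : 2 * (c + a * s) / (W + a)
              = 2 * c / W * ((a * s / c + 1) * (1 + a / W)⁻¹) := by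
            have : 1 + a / W = (W + a) / W := by field_simp
            rw [this]
            field_simp
            ring
          rw [e1]
          refine mul_le_mul_of_nonneg_left ?_ (by positivity)
          rw [Real.exp_add]
          have hinv : W⁻¹ ≤ 1 := inv_le_one_of_one_le₀ h1
          have hinv0 : 0 < W⁻¹ := inv_pos.mpr hWpos
          refine mul_le_mul (Real.add_one_le_exp _) ?_ ?_ (Real.exp_pos _).le
          · refine (inv_one_add_le_exp ?_).trans (Real.exp_le_exp.mpr ?_)
            · rw [div_eq_mul_inv, abs_mul, abs_of_pos hinv0]
              exact (mul_le_of_le_one_right (abs_nonneg a) hinv).trans ha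
            · have : a ^ 2 * (W⁻¹ * W⁻¹) ≤ a ^ 2 * (W⁻¹ * 1) := by gcongr
              rw [div_eq_mul_inv]
              nlinarith
          · have : 1 + a / W = (W + a) / W := by field_simp
            rw [this]
            positivity

lemma lorentzBall_eq (q : ℝ) (n : ℕ) :
    lorentzBall q n = {x | weightedNorm (fun k => ((k : ℝ) + 1) ^ (1 / q - 1)) x ≤ 1} := rfl

/-- The factor `vol(B)^{-1/n}` normalizing the Lorentz ball. -/
def normFactor (q : ℝ) (n : ℕ) : ℝ := (volume (lorentzBall q n)).toReal ^ (-(1 : ℝ) / n)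

lemma volume_lorentzBall_s14 (q : ℝ) {n : ℕ} (hn : 0 < n) :
    (volume (lorentzBall q n)).toReal = ∏ j ∈ Finset.range n, 2 / weightSum (1 / q) j := by
  have hpos := fun j => one_pos.trans_le (one_le_weightSum (1 / q) j)
  rw [lorentzBall_eq, volume_weightedNorm_le_one hn _ hpos, ENNReal.toReal_ofReal]
  · rfl
  · exact Finset.prod_nonneg fun j _ => div_nonneg zero_le_two (hpos j).le

lemma normFactor_eq_exp (q : ℝ) {n : ℕ} (hn : 0 < n) :
    normFactor q n = Real.exp ((n : ℝ)⁻¹ * ∑ j ∈ Finset.range n,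
      Real.log (weightSum (1 / q) j) - Real.log 2) := by
  have hpos := fun j => one_pos.trans_le (one_le_weightSum (1 / q) j)
  have hn' : (0 : ℝ) < n := by exact_mod_cast hn
  have hprod : 0 < ∏ j ∈ Finset.range n, 2 / weightSum (1 / q) j :=
    Finset.prod_pos fun j _ => div_pos two_pos (hpos j)
  rw [normFactor, volume_lorentzBall_s14 q hn, Real.rpow_def_of_pos hprod, Real.log_prod
    fun j _ => (div_pos two_pos (hpos j)).ne']
  congr 1
  rw [Finset.sum_congr rfl fun j _ => Real.log_div two_ne_zero (hpos j).ne',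
    Finset.sum_sub_distrib]
  simp only [Finset.sum_const, Finset.card_range, nsmul_eq_mul]
  field_simp
  ring

lemma normFactor_pos (q : ℝ) {n : ℕ} (hn : 0 < n) : 0 < normFactor q n := by
  rw [normFactor_eq_exp q hn]
  exact Real.exp_pos _

lemma prod_normFactor_div (q : ℝ) {n : ℕ} (hn : 0 < n) :
    ∏ j ∈ Finset.range n, 2 * normFactor q n / weightSum (1 / q) j = 1 := by
  have hpos := fun j => one_pos.trans_le (one_le_weightSum (1 / q) j)
  have hprod : 0 < ∏ j ∈ Finset.range n, 2 / weightSum (1 / q) j :=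
    Finset.prod_pos fun j _ => div_pos two_pos (hpos j)
  have h : ∀ j, 2 * normFactor q n / weightSum (1 / q) j
      = 2 / weightSum (1 / q) j * normFactor q n := fun j => by ring
  simp only [h]
  rw [Finset.prod_mul_distrib, Finset.prod_const, Finset.card_range, normFactor,
    volume_lorentzBall_s14 q hn, ← Real.rpow_mul_natCast hprod.le]
  have hn' : (n : ℝ) ≠ 0 := by exact_mod_cast hn.ne'
  rw [div_mul_cancel₀ _ hn', Real.rpow_neg_one, mul_inv_cancel₀ hprod.ne']

lemma volNormLorentzBall_eq (q : ℝ) {n : ℕ} (hn : 0 < n) :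
    volNormLorentzBall q n
      = {x | weightedNorm (fun k => ((k : ℝ) + 1) ^ (1 / q - 1)) x ≤ normFactor q n} := by
  have hc := normFactor_pos q hn
  ext x
  change x ∈ (fun x => normFactor q n • x) '' lorentzBall q n ↔ weightedNorm _ x ≤ _
  rw [lorentzBall_eq]
  constructor
  · rintro ⟨y, hy, rfl⟩
    change weightedNorm _ y ≤ 1 at hy
    change weightedNorm _ (normFactor q n • y) ≤ _
    rw [weightedNorm_smul _ hc.le]
    exact mul_le_of_le_one_right hc.le hy
  · intro h
    refine ⟨(normFactor q n)⁻¹ • x, ?_, smul_inv_smul₀ hc.ne' x⟩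
    change weightedNorm _ _ ≤ 1
    rw [weightedNorm_smul _ (inv_nonneg.mpr hc.le), inv_mul_le_iff₀ hc, mul_one]
    exact h

lemma volume_volNormLorentzBall (q : ℝ) {n : ℕ} (hn : 0 < n) :
    volume (volNormLorentzBall q n) = 1 := by
  have hpos := fun j => one_pos.trans_le (one_le_weightSum (1 / q) j)
  rw [volNormLorentzBall_eq q hn, volume_weightedNorm_le hn _ hpos (normFactor_pos q hn)]
  change ENNReal.ofReal (∏ j ∈ Finset.range n, 2 * normFactor q n / weightSum (1 / q) j) = 1
  rw [prod_normFactor_div q hn, ENNReal.ofReal_one]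

lemma tendsto_normFactor_div {q : ℝ} (hq : 1 < q) :
    Tendsto (fun n : ℕ => normFactor q n / (n : ℝ) ^ (1 / q)) atTop
      (nhds (q * Real.exp (-(1 / q)) / 2)) := by
  have hq0 : 0 < q := by linarith
  have h := ((tendsto_mean_log_weightSum (α := 1 / q) (by positivity)).sub_const
    (Real.log 2)).rexp
  have e : Real.exp (Real.log (1 / (1 / q)) - 1 / q - Real.log 2)
      = q * Real.exp (-(1 / q)) / 2 := by
    rw [Real.exp_sub, Real.exp_log two_pos, sub_eq_add_neg, Real.exp_add, one_div_one_div,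
      Real.exp_log hq0]
  rw [e] at h
  refine h.congr' ?_
  filter_upwards [eventually_gt_atTop 0] with n hn
  have hn' : (0 : ℝ) < n := by exact_mod_cast hn
  rw [normFactor_eq_exp q hn, Real.rpow_def_of_pos hn', ← Real.exp_sub]
  congr 1
  ring

lemma tendsto_normFactor_atTop {q : ℝ} (hq : 1 < q) :
    Tendsto (fun n : ℕ => normFactor q n) atTop atTop := by
  have hq0 : 0 < q := by linarith
  have hrpow : Tendsto (fun n : ℕ => (n : ℝ) ^ (1 / q)) atTop atTop :=
    (tendsto_rpow_atTop (by positivity)).comp tendsto_natCast_atTop_atTop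
  refine ((tendsto_normFactor_div hq).pos_mul_atTop (by positivity) hrpow).congr' ?_
  filter_upwards [eventually_gt_atTop 0] with n hn
  have hn' : (0 : ℝ) < n := by exact_mod_cast hn
  exact div_mul_cancel₀ _ (by positivity)

lemma tendsto_sum_inv_weightSum_atTop {α : ℝ} (hα : 0 < α) (hα1 : α < 1) :
    Tendsto (fun n : ℕ => ∑ j ∈ Finset.range n, (weightSum α j)⁻¹) atTop atTop := by
  have h1 : 0 < 1 - α := by linarith
  have hrpow : Tendsto (fun n : ℕ => (n : ℝ) ^ (1 - α)) atTop atTop :=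
    (tendsto_rpow_atTop h1).comp tendsto_natCast_atTop_atTop
  refine ((tendsto_sum_inv_weightSum hα hα1).pos_mul_atTop (by positivity) hrpow).congr' ?_
  filter_upwards [eventually_gt_atTop 0] with n hn
  have hn' : (0 : ℝ) < n := by exact_mod_cast hn
  exact div_mul_cancel₀ _ (by positivity)

lemma tendsto_normFactor_mul_sum_div {q : ℝ} (hq : 1 < q) :
    Tendsto (fun n : ℕ => normFactor q n *
      (∑ j ∈ Finset.range n, (weightSum (1 / q) j)⁻¹) / n) atTop
      (nhds (1 / (2 * Real.exp (1 / q)) * (q / (q - 1)))) := by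
  have hq0 : 0 < q := by linarith
  have hq1 : 0 < q - 1 := by linarith
  have hα1 : 1 / q < 1 := (div_lt_one hq0).mpr hq
  have h := (tendsto_normFactor_div hq).mul
    (tendsto_sum_inv_weightSum (α := 1 / q) (by positivity) hα1)
  have e : q * Real.exp (-(1 / q)) / 2 * (1 / q / (1 - 1 / q))
      = 1 / (2 * Real.exp (1 / q)) * (q / (q - 1)) := by
    have : 1 - 1 / q = (q - 1) / q := by field_simp
    rw [Real.exp_neg, this]
    have := (Real.exp_pos (1 / q)).ne'
    field_simp
  rw [e] at h
  refine h.congr' ?_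
  filter_upwards [eventually_gt_atTop 0] with n hn
  have hn' : (0 : ℝ) < n := by exact_mod_cast hn
  rw [div_mul_div_comm, ← Real.rpow_add hn', add_sub_cancel, Real.rpow_one]

lemma tendsto_volume_inter_volNormLorentzBall {q : ℝ} (hq : 1 < q) {a s : ℝ} (ha : |a| ≤ 1 / 2)
    (has : a * (s / (1 / (2 * Real.exp (1 / q)) * (q / (q - 1))) - 1 + 2 * a) < 0) :
    Tendsto (fun n : ℕ => volume ({x : Fin n → ℝ | a * (‖x‖ - s) ≤ 0} ∩ volNormLorentzBall q n))
      atTop (nhds 0) := by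
  have hq0 : 0 < q := by linarith
  have hq1 : 0 < q - 1 := by linarith
  have hα1 : 1 / q < 1 := (div_lt_one hq0).mpr hq
  set m := 1 / (2 * Real.exp (1 / q)) * (q / (q - 1)) with hm
  have hmpos : 0 < m := by positivity
  set S : ℕ → ℝ := fun n => ∑ j ∈ Finset.range n, (weightSum (1 / q) j)⁻¹ with hS
  have hSpos : ∀ᶠ n in atTop, 0 < S n :=
    (tendsto_sum_inv_weightSum_atTop (by positivity) hα1).eventually_gt_atTop 0
  have hexp : Tendsto (fun n : ℕ => (n : ℝ) * (a * s / normFactor q n) + (2 * a ^ 2 - a) * S n)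
      atTop atBot := by
    have h1 : Tendsto (fun n : ℕ => a * (s * (normFactor q n * S n / n)⁻¹ - 1 + 2 * a)) atTop
        (nhds (a * (s / m - 1 + 2 * a))) :=
      ((((tendsto_normFactor_mul_sum_div hq).inv₀ hmpos.ne').const_mul s).sub_const 1
        |>.add_const (2 * a)).const_mul a
    refine (h1.neg_mul_atTop has
      (tendsto_sum_inv_weightSum_atTop (by positivity) hα1)).congr' ?_
    filter_upwards [eventually_gt_atTop 0, hSpos] with n hn hSn
    have hn' : (0 : ℝ) < n := by exact_mod_cast hn
    have hc := normFactor_pos q hn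
    change _ * S n = _
    field_simp
    ring
  have hlim : Tendsto (fun n : ℕ => ENNReal.ofReal (Real.exp
      ((n : ℝ) * (a * s / normFactor q n) + (2 * a ^ 2 - a) * S n))) atTop (nhds 0) := by
    have := ENNReal.tendsto_ofReal (Real.tendsto_exp_atBot.comp hexp)
    rwa [ENNReal.ofReal_zero] at this
  refine tendsto_of_tendsto_of_tendsto_of_le_of_le' tendsto_const_nhds hlim
    (Eventually.of_forall fun _ => zero_le) ?_
  filter_upwards [eventually_gt_atTop 0,
    (tendsto_normFactor_atTop hq).eventually_gt_atTop (-(a * s))] with n hn hcn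
  rw [volNormLorentzBall_eq q hn]
  exact volume_weightedNorm_le_inter_le hn (1 / q) (normFactor_pos q hn) (by linarith) ha
    (prod_normFactor_div q hn)

/-- Theorem D (`1 < q < ∞`, `r = ∞`): for `X^{(n)}` uniform on the volume-normalized
Lorentz ball `D_{q,1}^n`, the sup norm `‖X^{(n)}‖_∞` converges in probability to
`m_{q,∞} = (1/(2e^{1/q})) q/(q-1)`. Here `‖·‖` on `Fin n → ℝ` is the sup norm. -/
theorem lln_sup_norm (q : ℝ) (hq : 1 < q)
    {Ω : Type*} [MeasurableSpace Ω] (P : Measure Ω) [IsProbabilityMeasure P]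
    (X : (n : ℕ) → Ω → Fin n → ℝ) (hXmeas : ∀ n, Measurable (X n))
    (hX : ∀ n, Measure.map (X n) P = unifOn (volNormLorentzBall q n)) :
    ∀ ε > 0, Tendsto (fun n : ℕ =>
        P {ω | ε < |‖X n ω‖ - 1 / (2 * Real.exp (1 / q)) * (q / (q - 1))|})
      atTop (nhds 0) := by
  intro ε hε
  have hq0 : 0 < q := by linarith
  have hq1 : 0 < q - 1 := by linarith
  set m := 1 / (2 * Real.exp (1 / q)) * (q / (q - 1)) with hm
  have hmpos : 0 < m := by positivity
  set δ := min (1 / 2) (ε / (4 * m)) with hδ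
  have hδpos : 0 < δ := lt_min (by norm_num) (by positivity)
  have hδ1 : δ ≤ 1 / 2 := min_le_left _ _
  have hδ2 : 2 * δ < ε / m := by
    have h1 : δ ≤ ε / (4 * m) := min_le_right _ _
    have h2 : ε / (4 * m) = ε / m / 4 := by field_simp
    have h3 : 0 < ε / m := by positivity
    linarith
  have hlow := tendsto_volume_inter_volNormLorentzBall hq (a := δ) (s := m - ε)
    (by rwa [abs_of_pos hδpos]) (by
      rw [← hm, sub_div, div_self hmpos.ne']
      exact mul_neg_of_pos_of_neg hδpos (by linarith))
  have hhigh := tendsto_volume_inter_volNormLorentzBall hq (a := -δ) (s := m + ε)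
    (by rwa [abs_neg, abs_of_pos hδpos]) (by
      rw [← hm, add_div, div_self hmpos.ne']
      exact mul_neg_of_neg_of_pos (by linarith) (by linarith))
  have hsum := hlow.add hhigh
  rw [add_zero] at hsum
  refine tendsto_of_tendsto_of_tendsto_of_le_of_le' tendsto_const_nhds hsum
    (Eventually.of_forall fun _ => zero_le) ?_
  filter_upwards [eventually_gt_atTop 0] with n hn
  have hmeas : MeasurableSet {x : Fin n → ℝ | ε < |‖x‖ - m|} :=
    measurableSet_lt measurable_const (by fun_prop)
  have hP : P {ω | ε < |‖X n ω‖ - m|}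
      = volume ({x : Fin n → ℝ | ε < |‖x‖ - m|} ∩ volNormLorentzBall q n) := by
    have h := Measure.map_apply (μ := P) (hXmeas n) hmeas
    rw [hX n, unifOn, volume_volNormLorentzBall q hn, inv_one, one_smul,
      Measure.restrict_apply hmeas] at h
    exact h.symm
  rw [hP]
  refine (measure_mono ?_).trans (measure_union_le _ _)
  rintro x ⟨hx, hxD⟩
  rcases lt_abs.mp (show ε < |‖x‖ - m| from hx) with h | h
  · exact Or.inr ⟨show -δ * (‖x‖ - (m + ε)) ≤ 0 by nlinarith, hxD⟩
  · exact Or.inl ⟨show δ * (‖x‖ - (m - ε)) ≤ 0 by nlinarith, hxD⟩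

end
end
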